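/- arXiv:1607.04781 — 5 statements merged into one kernel-verified Lean document; each statement's English description precedes it below -/
import Mathlib

section
/- Assume the Continuum Hypothesis (2^ℵ₀ = ℵ₁). Then every productively Lindelöf space of weight at most ℵ₁ is Alster. -/
open Set Function TopologicalSpace MeasureTheory

universe u

/-- A space is analytic if it is a continuous image of the Baire space `ℕ → ℕ`. -/
def IsAnalyticSpace (X : Type*) [TopologicalSpace X] : Prop :=
  ∃ f : (ℕ → ℕ) → X, Continuous f ∧ Surjective f

/-- A space is Lusin if it is an injective continuous image of the Baire space. -/
def IsLusinSpace (X : Type*) [TopologicalSpace X] : Prop :=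
  ∃ f : (ℕ → ℕ) → X, Continuous f ∧ Injective f ∧ Surjective f

/-- A map is perfect if it is continuous, closed, and has compact fibers. -/
def IsPerfectMap {X Y : Type*} [TopologicalSpace X] [TopologicalSpace Y] (f : X → Y) : Prop :=
  Continuous f ∧ IsClosedMap f ∧ ∀ y : Y, IsCompact (f ⁻¹' {y})

/-- The remainder `βX \ X` of a space in its Stone–Čech compactification. -/
def StoneCechRemainder (X : Type u) [TopologicalSpace X] : Set (StoneCech X) :=
  (Set.range (stoneCechUnit : X → StoneCech X))ᶜ

/-- A space is co-analytic if its Stone–Čech remainder is analytic. -/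
def CoAnalytic (X : Type u) [TopologicalSpace X] : Prop :=
  IsAnalyticSpace ↥(StoneCechRemainder X)

/-- A space is Čech-complete if it is a `Gδ` subset of its Stone–Čech compactification. -/
def CechComplete (X : Type u) [TopologicalSpace X] : Prop :=
  IsGδ (Set.range (stoneCechUnit : X → StoneCech X))

/-- A space is K-analytic if it is a continuous image of a Lindelöf Čech-complete
(Tychonoff) space. -/
def KAnalytic (X : Type u) [TopologicalSpace X] : Prop :=
  ∃ (Y : Type u) (_ : TopologicalSpace Y) (_ : T35Space Y),
    LindelofSpace Y ∧ CechComplete Y ∧ ∃ f : Y → X, Continuous f ∧ Surjective f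

/-- A space is K-Lusin if it is an injective continuous image of a Lindelöf Čech-complete
(Tychonoff) space. -/
def KLusin (X : Type u) [TopologicalSpace X] : Prop :=
  ∃ (Y : Type u) (_ : TopologicalSpace Y) (_ : T35Space Y),
    LindelofSpace Y ∧ CechComplete Y ∧ ∃ f : Y → X, Continuous f ∧ Injective f ∧ Surjective f

/-- The Menger property. -/
def MengerSpace (X : Type*) [TopologicalSpace X] : Prop :=
  ∀ U : ℕ → Set (Set X), (∀ n, ∀ u ∈ U n, IsOpen u) → (∀ n, ⋃₀ U n = univ) →
    ∃ V : ℕ → Set (Set X), (∀ n, V n ⊆ U n ∧ (V n).Finite) ∧ ⋃₀ (⋃ n, V n) = univ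

/-- The Rothberger property. -/
def RothbergerSpace (X : Type*) [TopologicalSpace X] : Prop :=
  ∀ U : ℕ → Set (Set X), (∀ n, ∀ u ∈ U n, IsOpen u) → (∀ n, ⋃₀ U n = univ) →
    ∃ V : ℕ → Set X, (∀ n, V n ∈ U n) ∧ (⋃ n, V n) = univ

/-- A space is productively Lindelöf if its product with every Lindelöf (Tychonoff)
space is Lindelöf. -/
def ProductivelyLindelof (X : Type u) [TopologicalSpace X] : Prop :=
  ∀ (Y : Type u) (_ : TopologicalSpace Y) (_ : T35Space Y),
    LindelofSpace Y → LindelofSpace (X × Y)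

/-- A Michael space is a Lindelöf (Tychonoff) space whose product with the Baire space
is not Lindelöf. -/
def ExistsMichaelSpace : Prop :=
  ∃ (Y : Type u) (_ : TopologicalSpace Y) (_ : T35Space Y),
    LindelofSpace Y ∧ ¬ LindelofSpace (Y × (ℕ → ℕ))

/-- The Hurewicz property: every Čech-complete space in which `X` embeds contains a
σ-compact subspace containing the image of `X`. -/
def HurewiczSpace (X : Type u) [TopologicalSpace X] : Prop :=
  ∀ (Y : Type u) (_ : TopologicalSpace Y) (_ : T35Space Y), CechComplete Y →
    ∀ f : X → Y, Topology.IsEmbedding f → ∃ S : Set Y, IsSigmaCompact S ∧ range f ⊆ S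

/-- A space is projectively σ-compact if each of its continuous images in a separable
metrizable space is σ-compact. -/
def ProjectivelySigmaCompact (X : Type u) [TopologicalSpace X] : Prop :=
  ∀ (M : Type u) (_ : TopologicalSpace M) (_ : SeparableSpace M) (_ : MetrizableSpace M)
    (f : X → M), Continuous f → IsSigmaCompact (range f)

/-- A space is projectively countable if each of its continuous images in a separable
metrizable space is countable. -/
def ProjectivelyCountable (X : Type u) [TopologicalSpace X] : Prop :=
  ∀ (M : Type u) (_ : TopologicalSpace M) (_ : SeparableSpace M) (_ : MetrizableSpace M)
    (f : X → M), Continuous f → (range f).Countable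

/-- The Alster property. -/
def AlsterSpace (X : Type*) [TopologicalSpace X] : Prop :=
  ∀ G : Set (Set X), (∀ g ∈ G, IsGδ g) → ⋃₀ G = univ →
    (∀ K : Set X, IsCompact K → ∃ F : Set (Set X), F ⊆ G ∧ F.Finite ∧ K ⊆ ⋃₀ F) →
    ∃ C : Set (Set X), C ⊆ G ∧ C.Countable ∧ ⋃₀ C = univ

/-- A compact set has countable character if it has a countable neighborhood base of
open sets. -/
def HasCountableChar {X : Type*} [TopologicalSpace X] (L : Set X) : Prop :=
  ∃ B : ℕ → Set X, (∀ n, IsOpen (B n) ∧ L ⊆ B n) ∧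
    ∀ U : Set X, IsOpen U → L ⊆ U → ∃ n, B n ⊆ U

/-- A space is of countable type if every compact set is contained in a compact set
of countable character. -/
def CountableType (X : Type*) [TopologicalSpace X] : Prop :=
  ∀ K : Set X, IsCompact K → ∃ L : Set X, IsCompact L ∧ K ⊆ L ∧ HasCountableChar L

/-- A space is nowhere locally compact if no point has a compact neighborhood. -/
def NowhereLocallyCompact (X : Type*) [TopologicalSpace X] : Prop :=
  ∀ x : X, ∀ K ∈ nhds x, ¬ IsCompact (K : Set X)

/-- Weight at most `c`: there is a basis of cardinality at most `c`. -/
def WeightLE (X : Type u) [TopologicalSpace X] (c : Cardinal.{u}) : Prop :=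
  ∃ B : Set (Set X), IsTopologicalBasis B ∧ Cardinal.mk B ≤ c

/-- A space is Frolík if it is homeomorphic to a closed subspace of a countable product
of σ-compact (Tychonoff) spaces. -/
def FrolikSpace (X : Type u) [TopologicalSpace X] : Prop :=
  ∃ (Y : ℕ → Type u) (_ : ∀ n, TopologicalSpace (Y n)) (_ : ∀ n, T35Space (Y n))
    (_ : ∀ n, SigmaCompactSpace (Y n)) (C : Set (∀ n, Y n)),
    IsClosed C ∧ Nonempty (X ≃ₜ ↥C)

/-- An s-space: some compactification has a countable open source for `X`. -/
def SSpace (X : Type u) [TopologicalSpace X] : Prop :=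
  ∃ (K : Type u) (_ : TopologicalSpace K) (_ : CompactSpace K) (_ : T2Space K)
    (e : X → K), Topology.IsEmbedding e ∧ DenseRange e ∧
      ∃ S : Set (Set K), S.Countable ∧ (∀ s ∈ S, IsOpen s) ∧
        ∃ F : Set (Set (Set K)), (∀ T ∈ F, T ⊆ S ∧ T.Nonempty) ∧
          range e = ⋃ T ∈ F, ⋂₀ T

/-- A space is Lindelöf p if it admits a perfect map onto a separable metrizable space. -/
def LindelofP (X : Type u) [TopologicalSpace X] : Prop :=
  ∃ (M : Type u) (_ : TopologicalSpace M) (_ : SeparableSpace M) (_ : MetrizableSpace M)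
    (f : X → M), IsPerfectMap f ∧ Surjective f

/-- A space is proper K-analytic if it admits a perfect map onto an analytic subspace
of `ℝ^ω`. -/
def ProperKAnalytic (X : Type u) [TopologicalSpace X] : Prop :=
  ∃ A : Set (ℕ → ℝ), IsAnalyticSpace ↥A ∧ ∃ f : X → ↥A, IsPerfectMap f ∧ Surjective f

/-- A space is proper K-Lusin if it admits a perfect map onto a Lusin subspace of `ℝ^ω`. -/
def ProperKLusin (X : Type u) [TopologicalSpace X] : Prop :=
  ∃ A : Set (ℕ → ℝ), IsLusinSpace ↥A ∧ ∃ f : X → ↥A, IsPerfectMap f ∧ Surjective f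

/-- A space is absolute Borel if, viewed as a subset of its Stone–Čech compactification,
it belongs to the σ-algebra generated by the closed sets. -/
def AbsoluteBorel (X : Type u) [TopologicalSpace X] : Prop :=
  MeasurableSet[MeasurableSpace.generateFrom {s : Set (StoneCech X) | IsClosed s}]
    (Set.range (stoneCechUnit : X → StoneCech X))

open Topology Cardinal

section Saturation

variable {Ω : Type u} [LinearOrder Ω]

/-- The set of points of the cube that agree below `ξ` with some point of `A`. -/
def cubeSat (ξ : Ω) (A : Set (Ω → unitInterval)) : Set (Ω → unitInterval) :=
  (Iio ξ).domRestrict ⁻¹' ((Iio ξ).domRestrict '' A)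

lemma mem_cubeSat {ξ : Ω} {A : Set (Ω → unitInterval)} {z : Ω → unitInterval} :
    z ∈ cubeSat ξ A ↔ ∃ a ∈ A, ∀ i < ξ, a i = z i := by
  simp only [cubeSat, mem_preimage, mem_image, funext_iff, Subtype.forall, mem_Iio,
    domRestrict_apply]

lemma subset_cubeSat (ξ : Ω) (A : Set (Ω → unitInterval)) : A ⊆ cubeSat ξ A :=
  subset_preimage_image _ _

lemma cubeSat_mono (ξ : Ω) {A B : Set (Ω → unitInterval)} (h : A ⊆ B) :
    cubeSat ξ A ⊆ cubeSat ξ B :=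
  preimage_mono (image_mono h)

lemma cubeSat_anti {ξ η : Ω} (h : ξ ≤ η) (A : Set (Ω → unitInterval)) :
    cubeSat η A ⊆ cubeSat ξ A := by
  intro z hz
  obtain ⟨a, ha, hz⟩ := mem_cubeSat.1 hz
  exact mem_cubeSat.2 ⟨a, ha, fun i hi => hz i (hi.trans_le h)⟩

lemma cubeSat_cubeSat_subset {ξ η : Ω} (h : ξ ≤ η) (A : Set (Ω → unitInterval)) :
    cubeSat η (cubeSat ξ A) ⊆ cubeSat ξ A := by
  intro z hz
  obtain ⟨b, hb, hz⟩ := mem_cubeSat.1 hz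
  obtain ⟨a, ha, hab⟩ := mem_cubeSat.1 hb
  exact mem_cubeSat.2 ⟨a, ha, fun i hi => (hab i hi).trans (hz i (hi.trans_le h))⟩

lemma cubeSat_sUnion (ξ : Ω) (F : Set (Set (Ω → unitInterval))) :
    cubeSat ξ (⋃₀ F) = ⋃ A ∈ F, cubeSat ξ A := by
  simp only [cubeSat, sUnion_eq_biUnion, image_iUnion, preimage_iUnion]

lemma continuous_cubeRestrict (ξ : Ω) :
    Continuous ((Iio ξ).domRestrict : (Ω → unitInterval) → (Iio ξ → unitInterval)) :=
  continuous_pi fun i => continuous_apply i.1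

lemma IsClosed.isClosed_image_cubeRestrict {A : Set (Ω → unitInterval)} (hA : IsClosed A) (ξ : Ω) :
    IsClosed ((Iio ξ).domRestrict '' A) :=
  (hA.isCompact.image (continuous_cubeRestrict ξ)).isClosed

lemma IsClosed.isClosed_cubeSat {A : Set (Ω → unitInterval)} (hA : IsClosed A) (ξ : Ω) :
    IsClosed (cubeSat ξ A) :=
  (hA.isClosed_image_cubeRestrict ξ).preimage (continuous_cubeRestrict ξ)

/-- `Ω` looks like the first uncountable ordinal. -/
class OmegaOneLike (Ω : Type u) [LinearOrder Ω] : Prop where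
  countable_Iio : ∀ a : Ω, Countable (Iio a)
  uncountable : Uncountable Ω
  wf : WellFoundedLT Ω

variable [OmegaOneLike Ω]

instance (a : Ω) : Countable (Iio a) := OmegaOneLike.countable_Iio a

instance (a : Ω) : Countable (Iic a) := by
  rw [← Iio_insert]
  exact ((to_countable (Iio a)).insert a).to_subtype

lemma Set.Countable.exists_forall_lt {S : Set Ω} (hS : S.Countable) : ∃ b, ∀ a ∈ S, a < b := by
  by_contra! h
  have : (univ : Set Ω) ⊆ ⋃ a ∈ S, Iic a := fun b _ => by
    obtain ⟨a, ha, hb⟩ := h b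
    exact mem_biUnion ha hb
  have h2 : (univ : Set Ω).Countable :=
    (hS.biUnion fun a _ => to_countable (Iic a)).mono this
  have := OmegaOneLike.uncountable (Ω := Ω)
  exact not_countable_univ h2

lemma exists_gt_pair_of_omegaOneLike (a b : Ω) : ∃ c, a < c ∧ b < c := by
  obtain ⟨c, hc⟩ := (to_countable {a, b}).exists_forall_lt
  exact ⟨c, hc a (by simp), hc b (by simp)⟩

lemma IsClosed.exists_notMem_cubeSat {K : Set (Ω → unitInterval)} (hK : IsClosed K)
    {z : Ω → unitInterval} (hz : z ∉ K) : ∃ ξ, z ∉ cubeSat ξ K := by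
  obtain ⟨I, u, hu, hI⟩ := isOpen_pi_iff.1 hK.isOpen_compl z hz
  obtain ⟨ξ, hξ⟩ := (I.countable_toSet).exists_forall_lt
  refine ⟨ξ, fun h => ?_⟩
  obtain ⟨a, ha, h⟩ := mem_cubeSat.1 h
  refine hI (fun i hi => ?_) ha
  rw [h i (hξ i hi)]
  exact (hu i hi).2

lemma IsClosed.exists_cubeSat_subset {K U : Set (Ω → unitInterval)} (hK : IsClosed K)
    (hU : IsOpen U) (h : K ⊆ U) : ∃ ξ, cubeSat ξ K ⊆ U := by
  have := OmegaOneLike.uncountable (Ω := Ω)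
  by_contra! hne
  have : (⋂ ξ : Ω, cubeSat ξ K ∩ Uᶜ).Nonempty := by
    refine IsCompact.nonempty_iInter_of_directed_nonempty_isCompact_isClosed _ ?_ ?_ ?_ ?_
    · intro a b
      exact ⟨max a b, inter_subset_inter_left _ (cubeSat_anti (le_max_left a b) K),
        inter_subset_inter_left _ (cubeSat_anti (le_max_right a b) K)⟩
    · intro ξ
      obtain ⟨z, hz, hzU⟩ := not_subset.1 (hne ξ)
      exact ⟨z, hz, hzU⟩
    · exact fun ξ => ((hK.isClosed_cubeSat ξ).inter hU.isClosed_compl).isCompact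
    · exact fun ξ => (hK.isClosed_cubeSat ξ).inter hU.isClosed_compl
  obtain ⟨z, hz⟩ := this
  rw [mem_iInter] at hz
  by_cases hzK : z ∈ K
  · exact (hz (Classical.arbitrary Ω)).2 (h hzK)
  · obtain ⟨ξ, hξ⟩ := hK.exists_notMem_cubeSat hzK
    exact hξ (hz ξ).1

lemma IsLindelof.exists_notMem_cubeSat {E : Set (Ω → unitInterval)} (hE : IsLindelof E)
    {z : Ω → unitInterval} (hz : z ∉ E) : ∃ ξ, z ∉ cubeSat ξ E := by
  obtain ⟨t, ht, hEt⟩ := hE.elim_countable_subcover (fun i : Ω => {x | x i ≠ z i})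
    (fun i => isOpen_ne_fun (continuous_apply i) continuous_const) (fun x hx => by
      have : x ≠ z := fun h => hz (h ▸ hx)
      obtain ⟨i, hi⟩ := Function.ne_iff.1 this
      exact mem_iUnion.2 ⟨i, hi⟩)
  obtain ⟨ξ, hξ⟩ := ht.exists_forall_lt
  refine ⟨ξ, fun h => ?_⟩
  obtain ⟨a, ha, h⟩ := mem_cubeSat.1 h
  obtain ⟨i, hi, hai⟩ := mem_iUnion₂.1 (hEt ha)
  exact hai (h i (hξ i hi))

lemma IsClosed.isSigmaCompact_compl_cubeSat {K : Set (Ω → unitInterval)} (hK : IsClosed K) (ξ : Ω) :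
    IsSigmaCompact (cubeSat ξ K)ᶜ := by
  let := metrizableSpaceMetric (Iio ξ → unitInterval)
  obtain ⟨F, hF, -, hFU, -⟩ :=
    (hK.isClosed_image_cubeRestrict ξ).isOpen_compl.exists_iUnion_isClosed
  refine ⟨fun n => (Iio ξ).domRestrict ⁻¹' F n,
    fun n => ((hF n).preimage (continuous_cubeRestrict ξ)).isCompact, ?_⟩
  rw [← preimage_iUnion, hFU]
  rfl

lemma isLindelof_of_forall_cubeSat {B : Set (Ω → unitInterval)}
    (hB : ∀ K, IsClosed K → Disjoint K B → ∃ ξ, Disjoint (cubeSat ξ K) B) : IsLindelof B := by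
  refine isLindelof_of_countable_subcover fun {ι} U hU hBU => ?_
  obtain ⟨ξ, hξ⟩ := hB (⋃ i, U i)ᶜ (isOpen_iUnion hU).isClosed_compl
    (disjoint_compl_left_iff_subset.2 hBU)
  obtain ⟨t, ht, h⟩ := ((isOpen_iUnion hU).isClosed_compl.isSigmaCompact_compl_cubeSat
    ξ).isLindelof.elim_countable_subcover U hU
      (compl_subset_comm.1 (subset_cubeSat ξ _))
  exact ⟨t, ht, (subset_compl_iff_disjoint_left.2 hξ).trans h⟩

lemma IsLindelof.exists_disjoint_cubeSat {B K : Set (Ω → unitInterval)} (hB : IsLindelof B)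
    (hK : IsClosed K) (h : Disjoint K B) : ∃ ξ, Disjoint (cubeSat ξ K) B := by
  obtain ⟨t, ht, hBt⟩ := hB.elim_countable_subcover (fun ξ : Ω => (cubeSat ξ K)ᶜ)
    (fun ξ => (hK.isClosed_cubeSat ξ).isOpen_compl) (fun z hz => by
      obtain ⟨ξ, hξ⟩ := hK.exists_notMem_cubeSat (h.notMem_of_mem_right hz)
      exact mem_iUnion.2 ⟨ξ, hξ⟩)
  obtain ⟨η, hη⟩ := ht.exists_forall_lt
  refine ⟨η, disjoint_left.2 fun z hz hzB => ?_⟩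
  obtain ⟨ξ, hξ, hzξ⟩ := mem_iUnion₂.1 (hBt hzB)
  exact hzξ (cubeSat_anti (hη ξ hξ).le K hz)

/-- `c` lists all closed sets of the cube that are saturated at some level. -/
structure IsClosedListing (c : Ω → Ω → Set (Ω → unitInterval)) : Prop where
  isClosed : ∀ η α, IsClosed (c η α)
  sat : ∀ η α, cubeSat η (c η α) ⊆ c η α
  exists_eq : ∀ η K, IsClosed K → ∃ α, c η α = cubeSat η K

lemma exists_isClosedListing (hΩ : 𝔠 ≤ #Ω) :
    ∃ c : Ω → Ω → Set (Ω → unitInterval), IsClosedListing c := by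
  have key : ∀ η : Ω, ∃ f : Ω → Set (Ω → unitInterval),
      (∀ α, IsClosed (f α)) ∧ (∀ α, cubeSat η (f α) ⊆ f α) ∧
        ∀ K, IsClosed K → ∃ α, f α = cubeSat η K := by
    intro η
    let b := countableBasis (Iio η → unitInterval)
    have hb : #(Set b) ≤ #Ω := by
      rw [mk_set]
      refine le_trans ?_ hΩ
      rw [← two_power_aleph0]
      have : Countable b := (countable_countableBasis _).to_subtype
      exact power_le_power_left two_ne_zero (mk_le_aleph0)
    obtain ⟨j⟩ := hb
    let g : Ω → Set b := invFun j
    have hg : Surjective g := invFun_surjective j.injective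
    refine ⟨fun α => (Iio η).domRestrict ⁻¹' (⋃ u ∈ g α, (u : Set (Iio η → unitInterval)))ᶜ,
      fun α => ?_, fun α z hz => ?_, fun K hK => ?_⟩
    · refine IsClosed.preimage (continuous_cubeRestrict η) (IsOpen.isClosed_compl ?_)
      exact isOpen_biUnion fun u _ => isOpen_of_mem_countableBasis u.2
    · obtain ⟨a, ha, haz⟩ := hz
      rw [mem_preimage, ← haz]
      exact ha
    · obtain ⟨α, hα⟩ := hg {u | (u : Set (Iio η → unitInterval)) ⊆ ((Iio η).domRestrict '' K)ᶜ}
      refine ⟨α, ?_⟩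
      have : ⋃ u ∈ g α, (u : Set (Iio η → unitInterval)) = ((Iio η).domRestrict '' K)ᶜ := by
        rw [hα]
        refine Subset.antisymm (iUnion₂_subset fun u hu => hu) fun z hz => ?_
        obtain ⟨u, hu, hzu, huK⟩ := (isBasis_countableBasis _).exists_subset_of_mem_open hz
          (hK.isClosed_image_cubeRestrict η).isOpen_compl
        exact mem_biUnion (show (⟨u, hu⟩ : b) ∈ _ from huK) hzu
      simp only [this, compl_compl, cubeSat]
  choose c h1 h2 h3 using key
  exact ⟨c, h1, h2, h3⟩

end Saturation

section Separation

lemma isLindelof_prod_infty_union_range {Z Ω : Type*} [TopologicalSpace Z] [TopologicalSpace Ω]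
    [DiscreteTopology Ω] {B : Set Z} (hB : IsLindelof B) (x : Ω → Z)
    (hx : ∀ K, IsClosed K → Disjoint K B → {ξ | x ξ ∈ K}.Countable) :
    IsLindelof (B ×ˢ {OnePoint.infty} ∪ range fun ξ => (x ξ, (ξ : OnePoint Ω))) := by
  refine isLindelof_of_countable_subcover fun {ι} U hU hcov => ?_
  have h1 : ∀ b ∈ B, ∃ i W, IsOpen W ∧ b ∈ W ∧ W ×ˢ {OnePoint.infty} ⊆ U i ∧
      {ξ : Ω | ¬ W ×ˢ {(ξ : OnePoint Ω)} ⊆ U i}.Finite := by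
    intro b hb
    obtain ⟨i, hi⟩ := mem_iUnion.1 (hcov (Or.inl ⟨hb, rfl⟩ : (b, OnePoint.infty) ∈ _))
    obtain ⟨W, V, hW, hV, hbW, hV', hWV⟩ := isOpen_prod_iff.1 (hU i) _ _ hi
    refine ⟨i, W, hW, hbW, (prod_mono_right (singleton_subset_iff.2 hV')).trans hWV, ?_⟩
    refine (((OnePoint.isOpen_iff_of_mem hV').1 hV).2.finite_of_discrete).subset fun ξ hξ hξV => ?_
    exact hξ (Subset.trans (prod_mono_right (singleton_subset_iff.2 hξV)) hWV)
  choose i W hW hbW hinf hfin using h1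
  obtain ⟨t, ht, hBt⟩ := hB.elim_nhds_subcover' W fun b hb => (hW b hb).mem_nhds (hbW b hb)
  have h2 : ∀ ξ, ∃ j, (x ξ, (ξ : OnePoint Ω)) ∈ U j := fun ξ =>
    mem_iUnion.1 (hcov (Or.inr (mem_range_self ξ)))
  choose j hj using h2
  let bad : Set Ω := {ξ | x ξ ∈ (⋃ b ∈ t, W b.1 b.2)ᶜ} ∪
    ⋃ b ∈ t, {ξ : Ω | ¬ W b.1 b.2 ×ˢ {(ξ : OnePoint Ω)} ⊆ U (i b.1 b.2)}
  have hbad : bad.Countable :=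
    (hx _ (isOpen_biUnion fun b _ => hW b.1 b.2).isClosed_compl
      (disjoint_compl_left_iff_subset.2 hBt)).union
      (ht.biUnion fun b _ => (hfin b.1 b.2).countable)
  refine ⟨(fun b : B => i b.1 b.2) '' t ∪ j '' bad, (ht.image _).union (hbad.image _), ?_⟩
  rintro p (⟨hp, hp'⟩ | ⟨ξ, rfl⟩)
  · obtain ⟨b, hb, hpb⟩ := mem_iUnion₂.1 (hBt hp)
    exact mem_biUnion (Or.inl (mem_image_of_mem _ hb)) (hinf b.1 b.2 ⟨hpb, hp'⟩)
  · by_cases hξ : ξ ∈ bad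
    · exact mem_biUnion (Or.inr (mem_image_of_mem _ hξ)) (hj ξ)
    · obtain ⟨h3, h4⟩ := not_or.1 hξ
      obtain ⟨b, hb, hxb⟩ := mem_iUnion₂.1 (not_not.1 h3)
      have h5 : W b.1 b.2 ×ˢ {(ξ : OnePoint Ω)} ⊆ U (i b.1 b.2) := by
        by_contra h
        exact h4 (mem_biUnion hb h)
      exact mem_biUnion (Or.inl (mem_image_of_mem _ hb)) (h5 ⟨hxb, rfl⟩)

variable {X Ω : Type u} [TopologicalSpace X]

lemma ProductivelyLindelof.countable_of_prod_infty_union_range {Z : Type u} [TopologicalSpace Z]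
    [CompactSpace Z] [T2Space Z] (hX : ProductivelyLindelof X) {e : X → Z} (he : Continuous e)
    {B : Set Z} (hB : IsLindelof B) (hd : Disjoint (range e) B) (x : Ω → X)
    (hx : ∀ K, IsClosed K → Disjoint K B → {ξ | e (x ξ) ∈ K}.Countable) : Countable Ω := by
  let _ : TopologicalSpace Ω := ⊥
  have : DiscreteTopology Ω := ⟨rfl⟩
  let Y : Set (Z × OnePoint Ω) :=
    B ×ˢ {OnePoint.infty} ∪ range fun ξ => (e (x ξ), (ξ : OnePoint Ω))
  have hY : LindelofSpace Y :=
    isLindelof_iff_lindelofSpace.1 (isLindelof_prod_infty_union_range hB (e ∘ x) hx)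
  have hXY := hX Y inferInstance inferInstance hY
  let D : Set (X × Y) := {p | e p.1 = p.2.1.1}
  have hD : IsLindelof D := IsClosed.isLindelof
    (isClosed_eq (he.comp continuous_fst)
      (continuous_fst.comp (continuous_subtype_val.comp continuous_snd)))
  obtain ⟨t, ht, hDt⟩ := hD.elim_countable_subcover
    (fun ξ : Ω => {p : X × Y | p.2.1.2 ∈ OnePoint.some '' ({ξ} : Set Ω)})
    (fun ξ => (OnePoint.isOpenMap_coe _ (isOpen_discrete {ξ})).preimage
      (continuous_snd.comp (continuous_subtype_val.comp continuous_snd))) (by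
      rintro ⟨a, ⟨y, hy⟩⟩ hp
      rcases hy with hy | ⟨ξ, rfl⟩
      · exact (hd.notMem_of_mem_left (mem_range_self a) ((show e a = y.1 from hp) ▸ hy.1)).elim
      · exact mem_iUnion.2 ⟨ξ, ξ, rfl, rfl⟩)
  refine countable_univ_iff.1 (ht.mono fun ξ _ => ?_)
  obtain ⟨η, hη, ζ, hζ, h⟩ := mem_iUnion₂.1
    (hDt (show (x ξ, (⟨(e (x ξ), (ξ : OnePoint Ω)), Or.inr ⟨ξ, rfl⟩⟩ : Y)) ∈ D from rfl))
  rw [← OnePoint.coe_injective h, show ζ = η from hζ]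
  exact hη

variable [LinearOrder Ω] [OmegaOneLike Ω]

lemma ProductivelyLindelof.exists_countable_isClosed_cover (hX : ProductivelyLindelof X)
    {e : X → Ω → unitInterval} (he : Continuous e) {c : Ω → Ω → Set (Ω → unitInterval)}
    (hc : IsClosedListing c) {B : Set (Ω → unitInterval)} (hB : IsLindelof B)
    (hd : Disjoint (range e) B) : ∃ F : Set (Set (Ω → unitInterval)), F.Countable ∧
      (∀ A ∈ F, IsClosed A ∧ Disjoint A B) ∧ range e ⊆ ⋃₀ F := by
  by_contra! hne
  have h1 : ∀ ξ : Ω, ∃ a : X, ∀ η < ξ, ∀ α < ξ, Disjoint (c η α) B → e a ∉ c η α := by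
    intro ξ
    by_contra! h
    refine hne ((fun p : Ω × Ω => c p.1 p.2) '' {p ∈ Iio ξ ×ˢ Iio ξ | Disjoint (c p.1 p.2) B})
      (((to_countable (Iio ξ)).prod (to_countable (Iio ξ))).mono (sep_subset _ _) |>.image _) ?_ ?_
    · rintro _ ⟨p, hp, rfl⟩
      exact ⟨hc.isClosed _ _, hp.2⟩
    · rintro _ ⟨a, rfl⟩
      obtain ⟨η, hη, α, hα, hB', ha⟩ := h a
      exact mem_sUnion_of_mem ha ⟨(η, α), ⟨⟨hη, hα⟩, hB'⟩, rfl⟩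
  choose x hx using h1
  have := hX.countable_of_prod_infty_union_range he hB hd x fun K hK hKB => by
    obtain ⟨η, hη⟩ := hB.exists_disjoint_cubeSat hK hKB
    obtain ⟨α, hα⟩ := hc.exists_eq η K hK
    refine (to_countable (Iic (max η α))).mono fun ξ hξ => ?_
    by_contra! h
    simp only [mem_Iic, not_le, max_lt_iff] at h
    exact hx ξ η h.1 α h.2 (hα ▸ hη) (hα ▸ subset_cubeSat η K hξ)
  have := OmegaOneLike.uncountable (Ω := Ω)
  exact not_countable (α := Ω) ‹_›

lemma ProductivelyLindelof.exists_countable_isClosed_eq_cubeSat (hX : ProductivelyLindelof X)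
    {e : X → Ω → unitInterval} (he : Continuous e) {c : Ω → Ω → Set (Ω → unitInterval)}
    (hc : IsClosedListing c) (ξ : Ω) : ∃ F : Set (Set (Ω → unitInterval)), F.Countable ∧
      (∀ A ∈ F, IsClosed A ∧ cubeSat ξ A ⊆ A) ∧ ⋃₀ F = cubeSat ξ (range e) := by
  have hB : IsLindelof (cubeSat ξ (range e))ᶜ := isLindelof_of_forall_cubeSat fun K _ hKB =>
    ⟨ξ, disjoint_compl_right_iff_subset.2 <|
      (cubeSat_mono ξ (disjoint_compl_right_iff_subset.1 hKB)).trans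
        (cubeSat_cubeSat_subset le_rfl _)⟩
  obtain ⟨F, hF, hFc, hFe⟩ := hX.exists_countable_isClosed_cover he hc hB
    (disjoint_compl_right_iff_subset.2 (subset_cubeSat ξ _))
  refine ⟨cubeSat ξ '' F, hF.image _, ?_, Subset.antisymm ?_ ?_⟩
  · rintro _ ⟨A, hA, rfl⟩
    exact ⟨(hFc A hA).1.isClosed_cubeSat ξ, cubeSat_cubeSat_subset le_rfl _⟩
  · rintro z ⟨_, ⟨A, hA, rfl⟩, hz⟩
    exact cubeSat_cubeSat_subset le_rfl _
      (cubeSat_mono ξ (disjoint_compl_right_iff_subset.1 (hFc A hA).2) hz)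
  · intro z hz
    have := cubeSat_mono ξ hFe hz
    rw [cubeSat_sUnion] at this
    obtain ⟨A, hA, hz⟩ := mem_iUnion₂.1 this
    exact ⟨_, mem_image_of_mem _ hA, hz⟩

end Separation

section SigmaIdeal

/-- `S` is a `σ`-ideal of subsets of `α`. -/
structure IsSigmaIdeal {α : Type*} (S : Set α → Prop) : Prop where
  mono : ∀ ⦃A B⦄, A ⊆ B → S B → S A
  sUnion : ∀ F : Set (Set α), F.Countable → (∀ A ∈ F, S A) → S (⋃₀ F)

lemma IsSigmaIdeal.biUnion {α ι : Type*} {S : Set α → Prop} (hS : IsSigmaIdeal S) {t : Set ι}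
    (ht : t.Countable) {f : ι → Set α} (h : ∀ i ∈ t, S (f i)) : S (⋃ i ∈ t, f i) := by
  rw [← sUnion_image]
  exact hS.sUnion _ (ht.image f) (forall_mem_image.2 h)

lemma IsSigmaIdeal.empty {α : Type*} {S : Set α → Prop} (hS : IsSigmaIdeal S) : S ∅ := by
  simpa using hS.sUnion ∅ countable_empty (by simp)

variable {Ω : Type u} [LinearOrder Ω]

/-- A set is heavy if none of its saturations belongs to `S`. -/
def IsHeavy (S : Set (Ω → unitInterval) → Prop) (K : Set (Ω → unitInterval)) : Prop :=
  ∀ ξ, ¬ S (cubeSat ξ K)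

lemma IsHeavy.mono {S : Set (Ω → unitInterval) → Prop} (hS : IsSigmaIdeal S)
    {K L : Set (Ω → unitInterval)} (h : K ⊆ L) (hK : IsHeavy S K) : IsHeavy S L :=
  fun ξ hL => hK ξ (hS.mono (cubeSat_mono ξ h) hL)

/-- The part of `K` that is left after removing all light relatively open pieces. -/
def heavyKernel (S : Set (Ω → unitInterval) → Prop) (K : Set (Ω → unitInterval)) :
    Set (Ω → unitInterval) :=
  K \ ⋃₀ {U | IsOpen U ∧ ¬ IsHeavy S (K ∩ closure U)}

lemma heavyKernel_subset (S : Set (Ω → unitInterval) → Prop) (K : Set (Ω → unitInterval)) :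
    heavyKernel S K ⊆ K :=
  sdiff_subset

lemma IsClosed.isClosed_heavyKernel {K : Set (Ω → unitInterval)} (hK : IsClosed K)
    (S : Set (Ω → unitInterval) → Prop) : IsClosed (heavyKernel S K) :=
  hK.inter (isOpen_sUnion fun _ hU => hU.1).isClosed_compl

lemma exists_isOpen_inter_subset_cubeSat {K : Set (Ω → unitInterval)} (hK : IsClosed K)
    (hne : K.Nonempty) {F : Set (Set (Ω → unitInterval))} (hF : F.Countable)
    (hFc : ∀ A ∈ F, IsClosed A) (hKF : K ⊆ ⋃₀ F) (ζ : Ω) :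
    ∃ A ∈ F, ∃ U : Set (Iio ζ → unitInterval), IsOpen U ∧
      ((Iio ζ).domRestrict ⁻¹' U ∩ K).Nonempty ∧
      (Iio ζ).domRestrict ⁻¹' U ∩ K ⊆ cubeSat ζ A := by
  let L : Set (Iio ζ → unitInterval) := (Iio ζ).domRestrict '' K
  have : CompactSpace L :=
    isCompact_iff_compactSpace.1 (hK.isClosed_image_cubeRestrict ζ).isCompact
  have : Nonempty L := (hne.image _).to_subtype
  have : Countable F := hF.to_subtype
  obtain ⟨A, y, hy⟩ := nonempty_interior_of_iUnion_of_closed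
    (f := fun A : F => (Subtype.val ⁻¹' ((Iio ζ).domRestrict '' A.1) : Set L))
    (fun A => ((hFc A A.2).isClosed_image_cubeRestrict ζ).preimage continuous_subtype_val) (by
      refine eq_univ_of_forall ?_
      rintro ⟨_, z, hz, rfl⟩
      obtain ⟨A, hA, hzA⟩ := hKF hz
      exact mem_iUnion.2 ⟨⟨A, hA⟩, mem_image_of_mem _ hzA⟩)
  obtain ⟨U, hU, hUy⟩ := isOpen_induced_iff.1
    (isOpen_interior (s := (Subtype.val ⁻¹' ((Iio ζ).domRestrict '' A.1) : Set L)))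
  refine ⟨A, A.2, U, hU, ?_, ?_⟩
  · obtain ⟨_, z, hz, rfl⟩ := y
    rw [← hUy] at hy
    exact ⟨z, hy, hz⟩
  · rintro z ⟨hzU, hz⟩
    have h1 : (⟨_, mem_image_of_mem _ hz⟩ : L) ∈ Subtype.val ⁻¹' U := hzU
    rw [hUy] at h1
    have h2 := interior_subset h1
    exact h2

variable [OmegaOneLike Ω] {S : Set (Ω → unitInterval) → Prop}

lemma IsHeavy.inter_heavyKernel (hS : IsSigmaIdeal S) {K M : Set (Ω → unitInterval)}
    (hK : IsClosed K) (hM : IsClosed M) (hMK : M ⊆ K) (h : IsHeavy S M) :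
    IsHeavy S (M ∩ heavyKernel S K) := by
  intro η hη
  set A := cubeSat η (M ∩ heavyKernel S K) with hA
  have hL : IsLindelof (M ∩ Aᶜ) :=
    ((hM.inter (hK.isClosed_heavyKernel S)).isSigmaCompact_compl_cubeSat η).isLindelof.inter_left hM
  have hcov : M ∩ Aᶜ ⊆ ⋃₀ {U | IsOpen U ∧ ¬ IsHeavy S (K ∩ closure U)} := by
    intro q hq
    by_contra hq'
    exact hq.2 (subset_cubeSat η _ ⟨hq.1, hMK hq.1, hq'⟩)
  rw [sUnion_eq_iUnion] at hcov
  obtain ⟨t, ht, htM⟩ := hL.elim_countable_subcover _ (fun U => U.2.1) hcov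
  have h1 : ∀ U : {U | IsOpen U ∧ ¬ IsHeavy S (K ∩ closure U)},
      ∃ ξ, S (cubeSat ξ (K ∩ closure U.1)) := fun U => by
    have := U.2.2
    simpa only [IsHeavy, not_forall, not_not] using this
  choose g hg using h1
  obtain ⟨ξ, hξ⟩ := ((ht.image g).insert η).exists_forall_lt
  refine h ξ ?_
  have h2 : M ⊆ ⋃₀ insert A ((fun U => K ∩ closure U.1) '' t) := by
    intro q hq
    by_cases hqA : q ∈ A
    · exact mem_sUnion_of_mem hqA (mem_insert _ _)
    · obtain ⟨U, hU, hqU⟩ := mem_iUnion₂.1 (htM ⟨hq, hqA⟩)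
      exact mem_sUnion_of_mem (t := K ∩ closure U.1) ⟨hMK hq, subset_closure hqU⟩
        (Or.inr (mem_image_of_mem _ hU))
  refine hS.mono (cubeSat_mono ξ h2) ?_
  rw [cubeSat_sUnion]
  refine hS.biUnion ((ht.image _).insert A) ?_
  rintro _ (rfl | ⟨U, hU, rfl⟩)
  · exact hS.mono (cubeSat_cubeSat_subset (hξ η (mem_insert _ _)).le _) hη
  · exact hS.mono (cubeSat_anti (hξ _ (Or.inr (mem_image_of_mem g hU))).le _) (hg U)

lemma IsHeavy.exists_locally_heavy (hS : IsSigmaIdeal S) {K : Set (Ω → unitInterval)}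
    (hK : IsClosed K) (h : IsHeavy S K) : ∃ L ⊆ K, IsClosed L ∧ L.Nonempty ∧
      ∀ U, IsOpen U → (U ∩ L).Nonempty → IsHeavy S (L ∩ closure U) := by
  refine ⟨heavyKernel S K, heavyKernel_subset S K, hK.isClosed_heavyKernel S, ?_, ?_⟩
  · have h1 := h.inter_heavyKernel hS hK hK Subset.rfl
    have := OmegaOneLike.uncountable (Ω := Ω)
    by_contra! h2
    refine h1 (Classical.arbitrary Ω) ?_
    rw [h2, inter_empty, cubeSat, image_empty, preimage_empty]
    exact hS.empty
  · rintro U hU ⟨p, hpU, hp⟩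
    obtain ⟨V, hVp, hVc, hVU⟩ := exists_mem_nhds_isClosed_subset (hU.mem_nhds hpU)
    have h1 : IsHeavy S (K ∩ closure (interior V)) := by
      by_contra h1
      exact hp.2 (mem_sUnion_of_mem (mem_interior_iff_mem_nhds.2 hVp) ⟨isOpen_interior, h1⟩)
    refine (h1.inter_heavyKernel hS hK (hK.inter isClosed_closure) inter_subset_left).mono hS ?_
    exact fun q hq => ⟨hq.2, closure_mono (interior_subset.trans hVU) hq.1.2⟩

lemma exists_forall_isOpen_exists_notMem_cubeSat {E K : Set (Ω → unitInterval)}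
    (hE : IsLindelof E) (hK : ∀ U, IsOpen U → (U ∩ K).Nonempty → ∃ p ∈ U ∩ K, p ∉ E) (ξ : Ω) :
    ∃ ξ' > ξ, ∀ V : Set (Iio ξ → unitInterval), IsOpen V →
      ((Iio ξ).domRestrict ⁻¹' V ∩ K).Nonempty →
      ∃ p ∈ (Iio ξ).domRestrict ⁻¹' V ∩ K, p ∉ cubeSat ξ' E := by
  have h1 : ∀ V : Set (Iio ξ → unitInterval), ∃ η : Ω, IsOpen V →
      ((Iio ξ).domRestrict ⁻¹' V ∩ K).Nonempty →
      ∃ p ∈ (Iio ξ).domRestrict ⁻¹' V ∩ K, p ∉ cubeSat η E := by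
    intro V
    by_cases h : IsOpen V ∧ ((Iio ξ).domRestrict ⁻¹' V ∩ K).Nonempty
    · obtain ⟨p, hp, hpE⟩ := hK _ (h.1.preimage (continuous_cubeRestrict ξ)) h.2
      obtain ⟨η, hη⟩ := hE.exists_notMem_cubeSat hpE
      exact ⟨η, fun _ _ => ⟨p, hp, hη⟩⟩
    · exact ⟨ξ, fun h2 h3 => (h ⟨h2, h3⟩).elim⟩
  choose g hg using h1
  obtain ⟨ξ', hξ'⟩ := (((countable_countableBasis (Iio ξ → unitInterval)).image g).insert
    ξ).exists_forall_lt
  refine ⟨ξ', hξ' ξ (mem_insert _ _), ?_⟩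
  rintro V hV ⟨q, hqV, hqK⟩
  obtain ⟨b, hb, hqb, hbV⟩ :=
    (isBasis_countableBasis (Iio ξ → unitInterval)).exists_subset_of_mem_open
      (show (Iio ξ).domRestrict q ∈ V from hqV) hV
  obtain ⟨p, ⟨hpb, hpK⟩, hpE⟩ := hg b (isOpen_of_mem_countableBasis hb) ⟨q, hqb, hqK⟩
  exact ⟨p, ⟨hbV hpb, hpK⟩,
    fun h => hpE (cubeSat_anti (hξ' _ (Or.inr (mem_image_of_mem g hb))).le _ h)⟩

lemma exists_isLUB_range_of_omegaOneLike (s : ℕ → Ω) : ∃ ζ, IsLUB (range s) ζ := by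
  have := OmegaOneLike.wf (Ω := Ω)
  obtain ⟨b, hb⟩ := (countable_range s).exists_forall_lt
  obtain ⟨ζ, hζ, hmin⟩ := wellFounded_lt.has_min (upperBounds (range s))
    ⟨b, fun a ha => (hb a ha).le⟩
  exact ⟨ζ, hζ, fun a ha => not_lt.1 (hmin a ha)⟩

lemma exists_level_forall_isOpen_exists_notMem_cubeSat {E K : Set (Ω → unitInterval)}
    (hE : IsLindelof E) (hK : ∀ U, IsOpen U → (U ∩ K).Nonempty → ∃ p ∈ U ∩ K, p ∉ E) :
    ∃ ζ : Ω, ∀ V : Set (Iio ζ → unitInterval), IsOpen V →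
      ((Iio ζ).domRestrict ⁻¹' V ∩ K).Nonempty →
      ∃ p ∈ (Iio ζ).domRestrict ⁻¹' V ∩ K, p ∉ cubeSat ζ E := by
  have := OmegaOneLike.uncountable (Ω := Ω)
  choose g hgt hg using exists_forall_isOpen_exists_notMem_cubeSat hE hK
  let s : ℕ → Ω := fun n => g^[n] (Classical.arbitrary Ω)
  have hs : ∀ n, s (n + 1) = g (s n) := fun n => iterate_succ_apply' g n _
  have hmono : StrictMono s := strictMono_nat_of_lt_succ fun n => by
    rw [hs]
    exact hgt _
  obtain ⟨ζ, hζ⟩ := exists_isLUB_range_of_omegaOneLike s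
  refine ⟨ζ, ?_⟩
  rintro V hV ⟨q, hqV, hqK⟩
  obtain ⟨I, u, hu, hI⟩ := isOpen_pi_iff.1 hV _ hqV
  have h1 : ∀ i : Iio ζ, ∃ n, i.1 < s n := fun i => by
    obtain ⟨_, ⟨n, rfl⟩, hn⟩ := (lt_isLUB_iff hζ).1 i.2
    exact ⟨n, hn⟩
  choose m hm using h1
  let n := I.sup m
  have hn : ∀ i ∈ I, i.1 < s n := fun i hi =>
    (hm i).trans_le (hmono.monotone (Finset.le_sup hi))
  let W : Set (Iio (s n) → unitInterval) :=
    ⋂ i ∈ I, ⋂ h : i.1 < s n, {y | y ⟨i.1, h⟩ ∈ u i}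
  have hW : IsOpen W := isOpen_biInter_finset fun i hi => isOpen_iInter_of_finite fun h =>
    (hu i hi).1.preimage (continuous_apply (⟨i.1, h⟩ : Iio (s n)))
  obtain ⟨p, ⟨hpW, hpK⟩, hpE⟩ := hg (s n) W hW
    ⟨q, mem_iInter₂.2 fun i hi => mem_iInter.2 fun h => (hu i hi).2, hqK⟩
  refine ⟨p, ⟨hI fun i hi => ?_, hpK⟩, fun h => hpE ?_⟩
  · exact mem_iInter.1 (mem_iInter₂.1 hpW i hi) (hn i hi)
  · rw [← hs]
    exact cubeSat_anti (hζ.1 (mem_range_self _)) _ h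

end SigmaIdeal

section Captured

variable {Ω : Type u} [LinearOrder Ω] {c : Ω → Ω → Set (Ω → unitInterval)}
  {E : Set (Ω → unitInterval)} {S : Set (Ω → unitInterval) → Prop}

/-- The union of the relatively saturated parts of the listed sets that belong to `S`. -/
def capturedSet (c : Ω → Ω → Set (Ω → unitInterval)) (E : Set (Ω → unitInterval))
    (S : Set (Ω → unitInterval) → Prop) : Set (Ω → unitInterval) :=
  {z | ∃ η α, S (c η α) ∧ z ∈ c η α ∧ z ∈ cubeSat (max η α) E}

lemma mem_cubeSat_or_of_mem_capturedSet {p : Ω → unitInterval} (hp : p ∈ capturedSet c E S)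
    (ζ : Ω) : p ∈ cubeSat ζ E ∨
      ∃ η < ζ, ∃ α < ζ, S (c η α) ∧ p ∈ c η α ∧ p ∈ cubeSat (max η α) E := by
  obtain ⟨η, α, hS, hpc, hpE⟩ := hp
  rcases lt_or_ge (max η α) ζ with h | h
  · exact Or.inr ⟨η, (max_lt_iff.1 h).1, α, (max_lt_iff.1 h).2, hS, hpc, hpE⟩
  · exact Or.inl (cubeSat_anti h E hpE)

lemma mem_of_forall_lt_eq {A : Set (Ω → unitInterval)} {η ζ : Ω} (hA : cubeSat η A ⊆ A)
    (h : η ≤ ζ) {k p : Ω → unitInterval} (hk : k ∈ A) (hkp : ∀ i < ζ, k i = p i) : p ∈ A :=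
  hA (mem_cubeSat.2 ⟨k, hk, fun i hi => hkp i (hi.trans_le h)⟩)

lemma IsClosedListing.subset_capturedSet (hc : IsClosedListing c)
    (hES : ∀ L ⊆ E, IsClosed L → ∃ ξ, S (cubeSat ξ L)) : E ⊆ capturedSet c E S := by
  intro p hp
  obtain ⟨ξ, hξ⟩ := hES {p} (singleton_subset_iff.2 hp) isClosed_singleton
  obtain ⟨α, hα⟩ := hc.exists_eq ξ {p} isClosed_singleton
  exact ⟨ξ, α, hα ▸ hξ, hα ▸ subset_cubeSat ξ {p} rfl, subset_cubeSat _ E hp⟩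

variable [OmegaOneLike Ω]

lemma IsClosedListing.exists_cubeSat_subset_capturedSet (hc : IsClosedListing c)
    {K : Set (Ω → unitInterval)} (hK : IsClosed K) (hKO : K ⊆ capturedSet c E S) {ξ : Ω}
    (hξ : S (cubeSat ξ K)) : ∃ ζ, cubeSat ζ K ⊆ capturedSet c E S := by
  obtain ⟨α, hα⟩ := hc.exists_eq ξ K hK
  obtain ⟨ζ, hξζ, hαζ⟩ := exists_gt_pair_of_omegaOneLike ξ α
  refine ⟨ζ, fun p hp => ?_⟩
  obtain ⟨k, hk, hkp⟩ := mem_cubeSat.1 hp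
  rcases mem_cubeSat_or_of_mem_capturedSet (hKO hk) ζ with h | ⟨η, hη, β, hβ, hS, hkc, hkE⟩
  · refine ⟨ξ, α, hα ▸ hξ, ?_, ?_⟩
    · rw [hα]
      exact cubeSat_anti hξζ.le K hp
    · exact cubeSat_anti (max_le hξζ.le hαζ.le) E
        (mem_of_forall_lt_eq (cubeSat_cubeSat_subset le_rfl E) le_rfl h hkp)
  · exact ⟨η, β, hS, mem_of_forall_lt_eq (hc.sat η β) hη.le hkc hkp,
      mem_of_forall_lt_eq (cubeSat_cubeSat_subset le_rfl E) (max_lt hη hβ).le hkE hkp⟩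

lemma IsClosedListing.exists_cubeSat_of_subset_capturedSet (hc : IsClosedListing c)
    (hE : IsLindelof E) (hEF : ∀ ξ : Ω, ∃ F : Set (Set (Ω → unitInterval)), F.Countable ∧
      (∀ A ∈ F, IsClosed A ∧ cubeSat ξ A ⊆ A) ∧ ⋃₀ F = cubeSat ξ E)
    (hS : IsSigmaIdeal S) (hES : ∀ L ⊆ E, IsClosed L → ∃ ξ, S (cubeSat ξ L))
    {K : Set (Ω → unitInterval)} (hK : IsClosed K) (hKO : K ⊆ capturedSet c E S) :
    ∃ ξ, S (cubeSat ξ K) := by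
  by_contra! hheavy
  obtain ⟨L, hLK, hL, hLne, hLh⟩ := IsHeavy.exists_locally_heavy hS hK hheavy
  have hLh' : ∀ U, IsOpen U → (U ∩ L).Nonempty →
      ∀ A, (∃ ξ, S (cubeSat ξ A)) → IsClosed A → ¬ U ∩ L ⊆ A := by
    rintro U hU ⟨p, hpU, hpL⟩ A ⟨ξ, hξ⟩ - hUA
    obtain ⟨V, hVp, hVc, hVU⟩ := exists_mem_nhds_isClosed_subset (hU.mem_nhds hpU)
    refine hLh (interior V) isOpen_interior ⟨p, mem_interior_iff_mem_nhds.2 hVp, hpL⟩ ξ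
      (hS.mono (cubeSat_mono ξ ?_) hξ)
    exact fun q hq => hUA ⟨hVU (closure_minimal interior_subset hVc hq.2), hq.1⟩
  have hLE : ∀ U, IsOpen U → (U ∩ L).Nonempty → ∃ p ∈ U ∩ L, p ∉ E := by
    rintro U hU ⟨p, hpU, hpL⟩
    by_contra! hUE
    obtain ⟨V, hVp, hVc, hVU⟩ := exists_mem_nhds_isClosed_subset (hU.mem_nhds hpU)
    refine hLh' (interior V) isOpen_interior ⟨p, mem_interior_iff_mem_nhds.2 hVp, hpL⟩ (V ∩ L)
      (hES _ (fun q hq => hUE q ⟨hVU hq.1, hq.2⟩) (hVc.inter hL)) (hVc.inter hL)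
      (inter_subset_inter_left _ interior_subset)
  obtain ⟨ζ, hζ⟩ := exists_level_forall_isOpen_exists_notMem_cubeSat hE hLE
  obtain ⟨F, hF, hFc, hFE⟩ := hEF ζ
  obtain ⟨A, hA, U, hU, hUne, hUA⟩ := exists_isOpen_inter_subset_cubeSat hL hLne
    (F := F ∪ (fun p : Ω × Ω => c p.1 p.2) '' {p ∈ Iio ζ ×ˢ Iio ζ | S (c p.1 p.2)})
    (hF.union ((((to_countable (Iio ζ)).prod (to_countable (Iio ζ))).mono
      (sep_subset _ _)).image _)) (by
      rintro A (hA | ⟨p, -, rfl⟩)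
      · exact (hFc A hA).1
      · exact hc.isClosed _ _) (by
      intro p hp
      rw [sUnion_union, hFE]
      rcases mem_cubeSat_or_of_mem_capturedSet (hKO (hLK hp)) ζ with
        h | ⟨η, hη, β, hβ, h, hpc, -⟩
      · exact Or.inl h
      · exact Or.inr (mem_sUnion_of_mem hpc ⟨(η, β), ⟨⟨hη, hβ⟩, h⟩, rfl⟩)) ζ
  have hU' := hU.preimage (continuous_cubeRestrict ζ)
  rcases hA with hA | ⟨⟨η, β⟩, ⟨⟨hη, -⟩, h⟩, rfl⟩
  · obtain ⟨p, hp, hpE⟩ := hζ U hU hUne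
    refine hpE ?_
    rw [← hFE]
    exact mem_sUnion_of_mem ((hFc A hA).2 (hUA hp)) hA
  · have hsat : cubeSat ζ (c η β) ⊆ c η β := (cubeSat_anti (le_of_lt hη) _).trans (hc.sat η β)
    exact hLh' _ hU' hUne _ ⟨ζ, hS.mono hsat h⟩ (hc.isClosed η β) (hUA.trans hsat)

lemma ProductivelyLindelof.sigmaIdeal_range {X : Type u} [TopologicalSpace X]
    (hX : ProductivelyLindelof X) {e : X → Ω → unitInterval} (he : Continuous e)
    (hE : IsLindelof (range e)) (hc : IsClosedListing c) (hS : IsSigmaIdeal S)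
    (hES : ∀ L ⊆ range e, IsClosed L → ∃ ξ, S (cubeSat ξ L)) : S (range e) := by
  have hcap : ∀ K, IsClosed K → K ⊆ capturedSet c (range e) S → ∃ ξ, S (cubeSat ξ K) :=
    fun K hK hKO => hc.exists_cubeSat_of_subset_capturedSet hE
      (hX.exists_countable_isClosed_eq_cubeSat he hc) hS hES hK hKO
  have hB : IsLindelof (capturedSet c (range e) S)ᶜ := isLindelof_of_forall_cubeSat
    fun K hK hKB => by
      have hKO := disjoint_compl_right_iff_subset.1 hKB
      obtain ⟨ξ, hξ⟩ := hcap K hK hKO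
      obtain ⟨ζ, hζ⟩ := hc.exists_cubeSat_subset_capturedSet hK hKO hξ
      exact ⟨ζ, disjoint_compl_right_iff_subset.2 hζ⟩
  obtain ⟨F, hF, hFB, hFE⟩ := hX.exists_countable_isClosed_cover he hc hB
    (disjoint_compl_right_iff_subset.2 (hc.subset_capturedSet hES))
  refine hS.mono hFE (hS.sUnion F hF fun A hA => ?_)
  obtain ⟨ξ, hξ⟩ := hcap A (hFB A hA).1 (disjoint_compl_right_iff_subset.1 (hFB A hA).2)
  exact hS.mono (subset_cubeSat ξ A) hξ

end Captured

section CubeEmbedding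

lemma exists_isInducing_cube {X Ω : Type u} [TopologicalSpace X] [CompletelyRegularSpace X]
    (hΩ : ℵ₀ ≤ #Ω) {B : Set (Set X)} (hB : IsTopologicalBasis B) (hBΩ : #B ≤ #Ω) :
    ∃ e : X → Ω → unitInterval, IsInducing e := by
  have hBB : #(B × B) ≤ #Ω := by
    rw [mk_prod, lift_id]
    exact (mul_le_mul' hBΩ hBΩ).trans (mul_eq_self hΩ).le
  obtain ⟨j⟩ := hBB
  have h1 : ∀ p : B × B, ∃ f : X → unitInterval, Continuous f ∧
      ((∃ f' : X → unitInterval, Continuous f' ∧ (∀ y ∈ p.1.1, (f' y : ℝ) < 1 / 2) ∧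
        ∀ y ∉ p.2.1, f' y = 1) →
      (∀ y ∈ p.1.1, (f y : ℝ) < 1 / 2) ∧ ∀ y ∉ p.2.1, f y = 1) := by
    intro p
    by_cases h : ∃ f' : X → unitInterval, Continuous f' ∧ (∀ y ∈ p.1.1, (f' y : ℝ) < 1 / 2) ∧
        ∀ y ∉ p.2.1, f' y = 1
    · obtain ⟨f, hf, h⟩ := h
      exact ⟨f, hf, fun _ => h⟩
    · exact ⟨fun _ => 0, continuous_const, fun h' => (h h').elim⟩
  choose f hf hf' using h1
  let g : Ω → X → unitInterval := extend j f fun _ _ => 0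
  have hg : ∀ ξ, Continuous (g ξ) := by
    intro ξ
    by_cases h : ∃ p, j p = ξ
    · obtain ⟨p, rfl⟩ := h
      simpa only [g, j.injective.extend_apply] using hf p
    · simpa only [g, extend_apply' _ _ _ h] using continuous_const
  have hcont : Continuous fun x ξ => g ξ x := continuous_pi hg
  refine ⟨fun x ξ => g ξ x, isInducing_iff_nhds.2 fun x => le_antisymm
    (Filter.map_le_iff_le_comap.1 hcont.continuousAt) fun s hs => ?_⟩
  obtain ⟨U, hU, hxU, hUs⟩ := hB.mem_nhds_iff.1 hs
  obtain ⟨f₀, hf₀, hf₀x, hf₀U⟩ := CompletelyRegularSpace.completely_regular x Uᶜ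
    (hB.isOpen hU).isClosed_compl (not_not.2 hxU)
  obtain ⟨V, hV, hxV, hVf⟩ := hB.exists_subset_of_mem_open
    (show x ∈ {y | (f₀ y : ℝ) < 1 / 2} by simp [hf₀x])
    (isOpen_lt (continuous_subtype_val.comp hf₀) continuous_const)
  obtain ⟨h2, h3⟩ := hf' (⟨V, hV⟩, ⟨U, hU⟩) ⟨f₀, hf₀, hVf, hf₀U⟩
  refine ⟨{z | (z (j (⟨V, hV⟩, ⟨U, hU⟩)) : ℝ) < 1 / 2}, ?_, fun y hy => ?_⟩
  · refine (isOpen_lt (continuous_subtype_val.comp (continuous_apply _))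
      continuous_const).mem_nhds ?_
    simpa only [g, mem_ofPred_eq, comp_apply, j.injective.extend_apply] using h2 x hxV
  · refine hUs (by_contra fun hyU => ?_)
    simp only [g, mem_preimage, mem_ofPred_eq, j.injective.extend_apply, h3 y hyU] at hy
    norm_num at hy

end CubeEmbedding

section Alster

instance : OmegaOneLike (aleph 1).ord.ToType where
  countable_Iio a := by
    rw [← mk_le_aleph0_iff, ← Order.lt_succ_iff, succ_aleph0]
    exact (mk_Iio_lt a (by simp)).trans_eq (mk_ord_toType _)
  uncountable := by
    rw [← aleph0_lt_mk_iff, mk_ord_toType]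
    exact aleph0_lt_aleph_one
  wf := inferInstance

lemma isSigmaIdeal_countably_covered {X Z : Type*} (e : X → Z) (G : Set (Set X)) :
    IsSigmaIdeal fun A : Set Z => ∃ C ⊆ G, C.Countable ∧ e ⁻¹' A ⊆ ⋃₀ C where
  mono := by
    rintro A B hAB ⟨C, hCG, hC, hBC⟩
    exact ⟨C, hCG, hC, (preimage_mono hAB).trans hBC⟩
  sUnion F hF h := by
    choose! C hCG hC hAC using h
    refine ⟨⋃ A ∈ F, C A, iUnion₂_subset hCG, hF.biUnion hC, ?_⟩
    rintro x ⟨A, hA, hx⟩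
    obtain ⟨D, hD, hxD⟩ := hAC A hA hx
    exact ⟨D, mem_biUnion hA hD, hxD⟩

lemma IsGδ.exists_preimage_cubeSat_subset {X Ω : Type*} [TopologicalSpace X] [LinearOrder Ω]
    [OmegaOneLike Ω] {e : X → Ω → unitInterval} (he : IsInducing e) {D : Set X} (hD : IsGδ D)
    {L : Set (Ω → unitInterval)} (hL : IsClosed L) (hLe : L ⊆ range e) (hLD : e ⁻¹' L ⊆ D) :
    ∃ ξ, e ⁻¹' cubeSat ξ L ⊆ D := by
  obtain ⟨f, hf, rfl⟩ := isGδ_iff_eq_iInter_nat.1 hD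
  have h1 : ∀ n, ∃ ξ, e ⁻¹' cubeSat ξ L ⊆ f n := by
    intro n
    obtain ⟨O, hO, hOf⟩ := he.isOpen_iff.1 (hf n)
    obtain ⟨ξ, hξ⟩ := hL.exists_cubeSat_subset hO (by
      intro z hz
      obtain ⟨x, rfl⟩ := hLe hz
      have : x ∈ f n := iInter_subset f n (hLD hz)
      rwa [← hOf] at this)
    exact ⟨ξ, hOf ▸ preimage_mono hξ⟩
  choose g hg using h1
  obtain ⟨ξ, hξ⟩ := (countable_range g).exists_forall_lt
  exact ⟨ξ, subset_iInter fun n =>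
    (preimage_mono (cubeSat_anti (hξ _ (mem_range_self n)).le L)).trans (hg n)⟩

end Alster

/-- CH implies productively Lindelöf spaces of weight at most ℵ₁ are Alster. -/
theorem ch_prodLindelof_weight_le_aleph_one_alster
    (ch : Cardinal.continuum.{u} = Cardinal.aleph 1)
    (X : Type u) [TopologicalSpace X] [T35Space X]
    (hPL : ProductivelyLindelof X) (hw : WeightLE X (Cardinal.aleph 1)) :
    AlsterSpace X := by
  intro G hG hGX hGK
  obtain ⟨B, hB, hBΩ⟩ := hw
  have hΩ : #(aleph.{u} 1).ord.ToType = aleph 1 := mk_ord_toType _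
  obtain ⟨e, he⟩ := exists_isInducing_cube (Ω := (aleph.{u} 1).ord.ToType)
    ((aleph0_le_aleph 1).trans_eq hΩ.symm) hB (hBΩ.trans_eq hΩ.symm)
  obtain ⟨c, hc⟩ := exists_isClosedListing (Ω := (aleph.{u} 1).ord.ToType) (ch.trans hΩ.symm).le
  have hX : LindelofSpace X := by
    have := hPL PUnit inferInstance inferInstance inferInstance
    rw [← isLindelof_univ_iff, ← (Prod.fst_surjective (α := X) (β := PUnit)).range_eq]
    exact isLindelof_range continuous_fst
  obtain ⟨C, hCG, hC, hXC⟩ := hPL.sigmaIdeal_range he.continuous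
    (isLindelof_range he.continuous) hc (isSigmaIdeal_countably_covered e G) (by
      intro L hLe hL
      obtain ⟨F, hFG, hF, hLF⟩ := hGK _ (he.isCompact_preimage' hL.isCompact hLe)
      obtain ⟨ξ, hξ⟩ := IsGδ.exists_preimage_cubeSat_subset he
        (IsGδ.sUnion hF fun g hg => hG g (hFG hg)) hL hLe hLF
      exact ⟨ξ, F, hFG, hF.countable, hξ⟩)
  exact ⟨C, hCG, hC, eq_univ_of_forall fun x => hXC (mem_range_self x)⟩
end

section
/- If there exists a Michael space, then every productively Lindelöf space is Menger. -/
open Set Function TopologicalSpace MeasureTheory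

universe u

open scoped Topology

/-- The image of a Lindelöf space under a compact-valued upper semicontinuous set-valued map
is Lindelöf. -/
theorem lindelofSpace_of_compactValued_usc {P Q : Type*} [TopologicalSpace P]
    [TopologicalSpace Q] [LindelofSpace P] (S : P → Set Q) (hc : ∀ p, IsCompact (S p))
    (husc : ∀ p, ∀ W, IsOpen W → S p ⊆ W → ∀ᶠ p' in 𝓝 p, S p' ⊆ W)
    (hs : ∀ q, ∃ p, q ∈ S p) : LindelofSpace Q := by
  refine ⟨isLindelof_of_countable_subcover fun {ι} U hU hcov => ?_⟩
  have hfin (p : P) : ∃ t : Finset ι, S p ⊆ ⋃ i ∈ t, U i :=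
    (hc p).elim_finite_subcover U hU ((subset_univ _).trans hcov)
  choose t ht using hfin
  obtain ⟨A, hA, hAu⟩ := LindelofSpace.elim_nhds_subcover
    (fun p => {p' | S p' ⊆ ⋃ i ∈ t p, U i})
    (fun p => husc p _ (isOpen_biUnion fun i _ => hU i) (ht p))
  refine ⟨⋃ p ∈ A, (t p : Set ι), hA.biUnion fun p _ => (t p).countable_toSet, fun q _ => ?_⟩
  obtain ⟨p', hq⟩ := hs q
  obtain ⟨p, hpA, hp⟩ := mem_iUnion₂.1 (hAu.ge (mem_univ p'))
  obtain ⟨i, hi, hqi⟩ := mem_iUnion₂.1 (hp hq)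
  exact mem_iUnion₂.2 ⟨i, mem_iUnion₂.2 ⟨p, hpA, hi⟩, hqi⟩

theorem isCompact_Iic_nat_pi (a : ℕ → ℕ) : IsCompact (Iic a) := by
  rw [← pi_univ_Iic]
  exact isCompact_univ_pi fun n => (finite_Iic (a n)).isCompact

/-- An open set of sequences containing all sequences below `a` contains every sequence which is
below `a` on a sufficiently long initial segment. -/
theorem exists_initialSegment_subset_of_Iic_subset {a : ℕ → ℕ} {W : Set (ℕ → ℕ)} (hW : IsOpen W)
    (haW : Iic a ⊆ W) : ∃ N, ∀ h : ℕ → ℕ, (∀ n < N, h n ≤ a n) → h ∈ W := by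
  have hcyl (g : ℕ → ℕ) : ∃ N, g ∈ W → PiNat.cylinder g N ⊆ W := by
    by_cases hg : g ∈ W
    · obtain ⟨_, ⟨y, N, rfl⟩, hgy, hy⟩ :=
        (PiNat.isTopologicalBasis_cylinders (fun _ : ℕ => ℕ)).exists_subset_of_mem_open hg hW
      exact ⟨N, fun _ => PiNat.mem_cylinder_iff_eq.1 hgy ▸ hy⟩
    · exact ⟨0, fun h => (hg h).elim⟩
  choose L hL using hcyl
  obtain ⟨t, hta, ht⟩ := (isCompact_Iic_nat_pi a).elim_nhds_subcover
    (fun g => PiNat.cylinder g (L g))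
    (fun g _ => (PiNat.isOpen_cylinder _ g _).mem_nhds (PiNat.self_mem_cylinder g _))
  refine ⟨t.sup L, fun h hh => ?_⟩
  have hmem : (fun n => if n < t.sup L then h n else 0) ∈ Iic a := fun n => by
    dsimp only
    split_ifs with hn
    · exact hh n hn
    · exact Nat.zero_le _
  obtain ⟨g, hgt, hg⟩ := mem_iUnion₂.1 (ht hmem)
  refine hL g (haW (hta g hgt)) fun n hn => ?_
  have hng := hg n hn
  simpa [hn.trans_le (Finset.le_sup hgt)] using hng

/-- If sublevel sets of the coordinates of `f` are open and every sequence is bounded by some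
value of `f`, then the Lindelöf property passes from `X × Y` to `Y × ℕ^ℕ`. -/
theorem lindelofSpace_prod_baire {X Y : Type*} [TopologicalSpace X] [TopologicalSpace Y]
    [LindelofSpace (X × Y)] (f : X → ℕ → ℕ) (hf : ∀ n k, IsOpen {x | f x n ≤ k})
    (hdom : ∀ g : ℕ → ℕ, ∃ x, g ≤ f x) : LindelofSpace (Y × (ℕ → ℕ)) := by
  refine lindelofSpace_of_compactValued_usc (P := X × Y) (fun p => {p.2} ×ˢ Iic (f p.1))
    (fun p => isCompact_singleton.prod (isCompact_Iic_nat_pi _)) ?_ ?_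
  · rintro ⟨x, y⟩ W hW hsub
    obtain ⟨A, B, hA, hB, hyA, hxB, hAB⟩ :=
      generalized_tube_lemma isCompact_singleton (isCompact_Iic_nat_pi (f x)) hW hsub
    obtain ⟨N, hN⟩ := exists_initialSegment_subset_of_Iic_subset hB hxB
    have hx : ∀ᶠ x' in 𝓝 x, ∀ n ∈ Iio N, f x' n ≤ f x n :=
      (Filter.eventually_all_finite (finite_Iio N)).2 fun n _ =>
        (hf n (f x n)).mem_nhds (le_refl (f x n))
    have hy : ∀ᶠ y' in 𝓝 y, y' ∈ A := hA.mem_nhds (hyA rfl)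
    filter_upwards [hx.prod_nhds hy]
    rintro ⟨x', y'⟩ ⟨hx', hy'⟩ ⟨z, h⟩ ⟨rfl, hh⟩
    exact hAB ⟨hy', hN h fun n hn => (hh n).trans (hx' n hn)⟩
  · rintro ⟨y, g⟩
    obtain ⟨x, hx⟩ := hdom g
    exact ⟨(x, y), rfl, hx⟩

/-- A Lindelöf space that is not Menger carries a sequence of upper semicontinuous functions into
`ℕ` which jointly dominate every sequence. -/
theorem exists_dominating_of_not_mengerSpace {X : Type*} [TopologicalSpace X] [LindelofSpace X]
    (hX : ¬ MengerSpace X) : ∃ f : X → ℕ → ℕ, (∀ n k, IsOpen {x | f x n ≤ k}) ∧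
      ∀ g : ℕ → ℕ, ∃ x, g ≤ f x := by
  classical
  unfold MengerSpace at hX
  push Not at hX
  obtain ⟨U, hUo, hUc, hU⟩ := hX
  have : Nonempty X := by
    by_contra h
    rw [not_nonempty_iff] at h
    exact hU (fun _ => ∅) (fun _ => ⟨empty_subset _, finite_empty⟩) (Subsingleton.elim _ _)
  have henum (n : ℕ) : ∃ C : ℕ → Set X, (∀ k, C k ∈ U n) ∧ ∀ x, ∃ k, x ∈ C k := by
    obtain ⟨t, htU, htc, htu⟩ := (isLindelof_univ (X := X)).elim_countable_subcover_image
      (b := U n) (c := id) (hUo n) (by rw [← hUc n, sUnion_eq_biUnion]; rfl)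
    have hcov (x : X) : ∃ u ∈ t, x ∈ u := by simpa using htu (mem_univ x)
    obtain ⟨u, hu, -⟩ := hcov (Classical.arbitrary X)
    obtain ⟨C, rfl⟩ := htc.exists_eq_range ⟨u, hu⟩
    exact ⟨C, fun k => htU (mem_range_self k), fun x => by simpa using hcov x⟩
  choose C hCU hC using henum
  refine ⟨fun x n => Nat.find (hC n x), fun n k => ?_, fun g => ?_⟩
  · have : {x | Nat.find (hC n x) ≤ k} = ⋃ m ∈ Iic k, C n m := by
      ext x
      simp [Nat.find_le_iff]
    rw [this]
    exact isOpen_biUnion fun m _ => hUo n _ (hCU n m)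
  · have hg := hU (fun n => C n '' Iic (g n)) fun n =>
      ⟨by rintro _ ⟨k, -, rfl⟩; exact hCU n k, (finite_Iic _).image _⟩
    obtain ⟨x, hx⟩ := (ne_univ_iff_exists_notMem _).1 hg
    refine ⟨x, fun n => (Nat.le_find_iff _ _).2 fun k hk hxk => hx ?_⟩
    exact ⟨C n k, mem_iUnion.2 ⟨n, k, hk.le, rfl⟩, hxk⟩

/-- If there is a Michael space, then productively Lindelöf spaces are Menger. -/
theorem michael_implies_prodLindelof_menger (hm : ExistsMichaelSpace.{u})
    (X : Type u) [TopologicalSpace X] [T35Space X]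
    (hPL : ProductivelyLindelof X) : MengerSpace X := by
  by_contra hX
  obtain ⟨Y, _, _, hY, hYB⟩ := hm
  have : LindelofSpace X := by
    have := hPL PUnit inferInstance inferInstance inferInstance
    exact .of_continuous_surjective continuous_fst (Prod.fst_surjective (β := PUnit.{u + 1}))
  obtain ⟨f, hf, hdom⟩ := exists_dominating_of_not_mengerSpace hX
  have := hPL Y _ ‹_› hY
  exact hYB (lindelofSpace_prod_baire f hf hdom)
end

section
/- There exists a Michael space if and only if every productively Lindelöf Čech-complete space is σ-compact. -/
open Set Function TopologicalSpace MeasureTheory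

universe u

open Topology

/-- The trace on `S` of a closed subset of a set with σ-compact trace is σ-compact. -/
lemma isSigmaCompact_inter_of_closed_subset {K : Type*} [TopologicalSpace K] {A B S : Set K}
    (hB : IsSigmaCompact (B ∩ S)) (hA : IsClosed A) (h : A ⊆ B) : IsSigmaCompact (A ∩ S) := by
  obtain ⟨L, hL, hLB⟩ := hB
  refine ⟨fun n ↦ A ∩ L n, fun n ↦ (hL n).inter_left hA, ?_⟩
  rw [← inter_iUnion, hLB, ← inter_assoc, inter_eq_left.2 h]

/-- If the trace of a closed set `F` on a Lindelöf `Gδ` subset `S` of a compact space is not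
σ-compact, then it fails to be σ-compact near some point outside `S`. -/
lemma exists_notMem_forall_nhds_not_isSigmaCompact {K : Type*} [TopologicalSpace K]
    [CompactSpace K] [T2Space K] {S F : Set K} (hS : IsLindelof S) (hG : IsGδ S)
    (hF : IsClosed F) (hFS : ¬ IsSigmaCompact (F ∩ S)) :
    ∃ z ∉ S, ∀ V ∈ 𝓝 z, IsClosed V → ¬ IsSigmaCompact (F ∩ V ∩ S) := by
  by_contra! hcon
  set F' : Set K := {z | ∀ V ∈ 𝓝 z, IsClosed V → ¬ IsSigmaCompact (F ∩ V ∩ S)} with hF'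
  have hF'S : F' ⊆ S := by
    intro z hz
    by_contra hzS
    obtain ⟨V, hV, hVc, hVs⟩ := hcon z hzS
    exact hz V hV hVc hVs
  have hF'c : IsClosed F' := by
    rw [← isOpen_compl_iff, isOpen_iff_mem_nhds]
    intro z hz
    simp only [hF', mem_compl_iff, mem_ofPred_eq, not_forall, not_not] at hz
    obtain ⟨V, hV, hVc, hVs⟩ := hz
    filter_upwards [interior_mem_nhds.2 hV] with w hw hw'
    exact hw' V (mem_interior_iff_mem_nhds.1 hw) hVc hVs
  obtain ⟨U, hU, rfl⟩ := isGδ_iff_eq_iInter_nat.1 hG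
  have hf (n : ℕ) : ∃ f : C(K, ℝ), EqOn f 0 F' ∧ EqOn f 1 (U n)ᶜ ∧ ∀ x, f x ∈ Icc (0 : ℝ) 1 :=
    exists_continuous_zero_one_of_isClosed hF'c (hU n).isClosed_compl
      (disjoint_compl_right_iff_subset.2 (hF'S.trans (iInter_subset U n)))
  choose f hf0 hf1 hf01 using hf
  set S : Set K := ⋂ n, U n
  have hlayer (n k : ℕ) : IsSigmaCompact (F ∩ {x | 1 / ((k : ℝ) + 1) ≤ f n x} ∩ S) := by
    have hc : IsClosed (F ∩ {x | 1 / ((k : ℝ) + 1) ≤ f n x}) :=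
      hF.inter (isClosed_le continuous_const (f n).continuous)
    have hV (x : K) (hx : x ∈ S ∩ (F ∩ {x | 1 / ((k : ℝ) + 1) ≤ f n x})) :
        ∃ V ∈ 𝓝 x, IsClosed V ∧ IsSigmaCompact (F ∩ V ∩ S) := by
      have : x ∉ F' := by
        intro hx'
        have h0 : f n x = 0 := hf0 n hx'
        have h1 : 1 / ((k : ℝ) + 1) ≤ f n x := hx.2.2
        have : (0 : ℝ) < 1 / ((k : ℝ) + 1) := by positivity
        linarith
      simpa [hF'] using this
    choose! V hV hVc hVs using hV
    obtain ⟨t, htc, ht, hcov⟩ := (hS.inter_right hc).elim_nhds_subcover V hV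
    have h1 : IsSigmaCompact (⋃ x ∈ t, (F ∩ V x ∩ S)) :=
      isSigmaCompact_biUnion htc fun x hx ↦ hVs x (ht x hx)
    have h2 : (⋃ x ∈ t, (F ∩ V x ∩ S)) = (⋃ x ∈ t, (F ∩ V x)) ∩ S := by
      simp only [iUnion_inter]
    rw [h2] at h1
    exact isSigmaCompact_inter_of_closed_subset (A := F ∩ {x | 1 / ((k : ℝ) + 1) ≤ f n x})
      (B := (⋃ x ∈ t, (F ∩ V x)) ∪ Sᶜ) (S := S) (by
        rwa [union_inter_distrib_right, compl_inter_self, union_empty]) hc (by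
        intro x hx
        by_cases hxS : x ∈ S
        · left
          obtain ⟨y, hy, hxy⟩ := mem_iUnion₂.1 (hcov ⟨hxS, hx⟩)
          exact mem_iUnion₂.2 ⟨y, hy, hx.1, hxy⟩
        · exact Or.inr hxS)
  have hLc : IsClosed (F ∩ ⋂ n, {x | f n x = 0}) :=
    hF.inter (isClosed_iInter fun n ↦ isClosed_eq (f n).continuous continuous_const)
  have hLS : (F ∩ ⋂ n, {x | f n x = 0}) ⊆ S := by
    intro x hx
    refine mem_iInter.2 fun n ↦ ?_
    by_contra hxn
    have h1 : f n x = 1 := hf1 n hxn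
    have h0 : f n x = 0 := mem_iInter.1 hx.2 n
    linarith
  apply hFS
  have key : F ∩ S = ⋃ b : Bool, cond b (F ∩ ⋂ n, {x | f n x = 0})
      (⋃ p : ℕ × ℕ, F ∩ {x | 1 / ((p.2 : ℝ) + 1) ≤ f p.1 x} ∩ S) := by
    ext x
    simp only [mem_iUnion, Bool.exists_bool, cond_false, cond_true]
    constructor
    · rintro ⟨hxF, hxS⟩
      by_cases h : ∀ n, f n x = 0
      · exact Or.inr ⟨hxF, mem_iInter.2 h⟩
      · push Not at h
        obtain ⟨n, hn⟩ := h
        obtain ⟨k, hk⟩ := exists_nat_one_div_lt (lt_of_le_of_ne (hf01 n x).1 hn.symm)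
        exact Or.inl ⟨(n, k), ⟨hxF, hk.le⟩, hxS⟩
    · rintro (⟨p, hp, hxS⟩ | h)
      · exact ⟨hp.1, hxS⟩
      · exact ⟨h.1, hLS h⟩
  rw [key]
  refine isSigmaCompact_iUnion _ ?_
  rintro (_ | _)
  · exact isSigmaCompact_iUnion _ fun p : ℕ × ℕ ↦ hlayer p.1 p.2
  · exact hLc.isCompact.isSigmaCompact

/-- A closed set whose trace on a Lindelöf `Gδ` subset `S` of a compact space is not σ-compact
contains a sequence of closed sets with the same property, discrete in `S`. -/
lemma exists_discrete_seq_not_isSigmaCompact {K : Type*} [TopologicalSpace K]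
    [CompactSpace K] [T2Space K] {S F U : Set K} (hS : IsLindelof S) (hG : IsGδ S)
    (hF : IsClosed F) (hFS : ¬ IsSigmaCompact (F ∩ S)) (hU : IsOpen U) (hSU : S ⊆ U) :
    ∃ E : ℕ → Set K, (∀ k, IsClosed (E k) ∧ ¬ IsSigmaCompact (E k ∩ S)) ∧ (∀ k, E k ⊆ F ∩ U) ∧
      ∀ x ∈ S, ∃ V ∈ 𝓝 x, ∀ i j, (V ∩ E i).Nonempty → (V ∩ E j).Nonempty → i = j := by
  obtain ⟨z, hzS, hz⟩ := exists_notMem_forall_nhds_not_isSigmaCompact hS hG hF hFS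
  have hSne : S.Nonempty := by
    rw [nonempty_iff_ne_empty]
    rintro rfl
    simp at hFS
  have hN (x : K) (hx : x ∈ S) : ∃ N ∈ 𝓝 x, IsClosed N ∧ N ⊆ U ∩ {z}ᶜ := by
    refine exists_mem_nhds_isClosed_subset
      ((hU.inter isOpen_compl_singleton).mem_nhds ⟨hSU hx, ?_⟩)
    rintro rfl
    exact hzS hx
  choose! M hM hMc hMU using hN
  obtain ⟨t, htc, ht, hcov⟩ := hS.elim_nhds_subcover (fun x ↦ interior (M x))
    fun x hx ↦ interior_mem_nhds.2 (hM x hx)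
  have htne : t.Nonempty := by
    obtain ⟨x, hx⟩ := hSne
    obtain ⟨y, hy, -⟩ := mem_iUnion₂.1 (hcov hx)
    exact ⟨y, hy⟩
  obtain ⟨g, rfl⟩ := htc.exists_eq_range htne
  set N : ℕ → Set K := fun i ↦ M (g i)
  have hNc (i : ℕ) : IsClosed (N i) := hMc _ (ht _ (mem_range_self i))
  have hNU (i : ℕ) : N i ⊆ U ∩ {z}ᶜ := hMU _ (ht _ (mem_range_self i))
  have hNcov (x : K) (hx : x ∈ S) : ∃ i, x ∈ interior (N i) := by
    simpa using hcov hx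
  have hW (m : ℕ) : ∃ W ∈ 𝓝 z, IsClosed W ∧ W ⊆ (⋃ i ∈ Iic m, N i)ᶜ := by
    refine exists_mem_nhds_isClosed_subset (IsOpen.mem_nhds ?_ ?_)
    · exact ((finite_Iic m).isClosed_biUnion fun i _ ↦ hNc i).isOpen_compl
    · simp only [mem_compl_iff, mem_iUnion, not_exists]
      exact fun i _ hi ↦ (hNU i hi).2 rfl
  choose W hWz hWc hWN using hW
  have hdisj {m i : ℕ} (h : i ≤ m) {x : K} (hx : x ∈ W m) : x ∉ N i := fun hxi ↦
    hWN m hx (mem_iUnion₂.2 ⟨i, h, hxi⟩)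
  have hnext (m : ℕ) : ∃ i, ¬ IsSigmaCompact (F ∩ W m ∩ N i ∩ S) := by
    by_contra! h
    apply hz (W m) (hWz m) (hWc m)
    have : F ∩ W m ∩ S = ⋃ i, F ∩ W m ∩ N i ∩ S := by
      ext x
      simp only [mem_iUnion]
      constructor
      · rintro ⟨hx, hxS⟩
        obtain ⟨i, hi⟩ := hNcov x hxS
        exact ⟨i, ⟨hx, interior_subset hi⟩, hxS⟩
      · rintro ⟨i, ⟨hx, -⟩, hxS⟩
        exact ⟨hx, hxS⟩
    rw [this]
    exact isSigmaCompact_iUnion _ h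
  choose i hi using hnext
  have hlt (m : ℕ) : m < i m := by
    by_contra! hle
    apply hi m
    convert isSigmaCompact_empty (X := K)
    rw [eq_empty_iff_forall_notMem]
    rintro x ⟨⟨⟨-, hxW⟩, hxN⟩, -⟩
    exact hdisj hle hxW hxN
  set m : ℕ → ℕ := fun k ↦ i^[k] 0 with hm
  have hmsucc (k : ℕ) : m (k + 1) = i (m k) := Function.iterate_succ_apply' i k 0
  have hmono : StrictMono m := strictMono_nat_of_lt_succ fun k ↦ by
    rw [hmsucc]; exact hlt _
  set E : ℕ → Set K := fun k ↦ F ∩ W (m k) ∩ N (m (k + 1)) with hE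
  have hEc (k : ℕ) : IsClosed (E k) := (hF.inter (hWc _)).inter (hNc _)
  have hEdisj {k l : ℕ} (h : k < l) {x : K} (hk : x ∈ E k) (hl : x ∈ E l) : False :=
    hdisj (hmono.monotone h) hl.1.2 hk.2
  refine ⟨E, fun k ↦ ⟨hEc k, ?_⟩, fun k x hx ↦ ⟨hx.1.1, (hNU _ hx.2).1⟩, fun x hx ↦ ?_⟩
  · simp only [hE, hmsucc]
    exact hi (m k)
  · obtain ⟨j, hj⟩ := hNcov x hx
    have hV : interior (N j) ∩ ⋂ k ∈ {k | k < j ∧ x ∉ E k}, (E k)ᶜ ∈ 𝓝 x := by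
      refine Filter.inter_mem (isOpen_interior.mem_nhds hj) ?_
      refine (Filter.biInter_mem ((finite_lt_nat j).subset fun k hk ↦ hk.1)).2 fun k hk ↦ ?_
      exact (hEc k).isOpen_compl.mem_nhds hk.2
    have hmem (k : ℕ)
        (h : (interior (N j) ∩ (⋂ k ∈ {k | k < j ∧ x ∉ E k}, (E k)ᶜ) ∩ E k).Nonempty) :
        x ∈ E k := by
      obtain ⟨y, ⟨hyj, hy⟩, hyk⟩ := h
      by_contra hxk
      have hkj : k < j := by
        by_contra! hle
        exact hdisj (hle.trans (hmono.id_le k)) hyk.1.2 (interior_subset hyj)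
      exact mem_iInter₂.1 hy k ⟨hkj, hxk⟩ hyk
    refine ⟨_, hV, fun k l hk hl ↦ ?_⟩
    rcases lt_trichotomy k l with h | h | h
    · exact (hEdisj h (hmem k hk) (hmem l hl)).elim
    · exact h
    · exact (hEdisj h (hmem l hl) (hmem k hk)).elim

/-- A Lindelöf `Gδ` subset of a compact space that is not σ-compact has a relatively closed subset
that maps continuously onto the Baire space. -/
theorem exists_closed_surjection_baire {K : Type*} [TopologicalSpace K]
    [CompactSpace K] [T2Space K] {S : Set K} (hS : IsLindelof S) (hG : IsGδ S)
    (hnS : ¬ IsSigmaCompact S) :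
    ∃ D : Set S, IsClosed D ∧ ∃ ψ : D → ℕ → ℕ, Continuous ψ ∧ Surjective ψ := by
  obtain ⟨U, hU, hSU⟩ := isGδ_iff_eq_iInter_nat.1 hG
  have hSUn (n : ℕ) : S ⊆ U n := hSU ▸ iInter_subset U n
  have step (F : {F : Set K // IsClosed F ∧ ¬ IsSigmaCompact (F ∩ S)}) (n : ℕ) :=
    exists_discrete_seq_not_isSigmaCompact hS hG F.2.1 F.2.2 (hU n) (hSUn n)
  choose E hE hEsub hEdisc using step
  let C : List ℕ → {F : Set K // IsClosed F ∧ ¬ IsSigmaCompact (F ∩ S)} := fun s ↦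
    List.rec ⟨univ, isClosed_univ, by rwa [univ_inter]⟩
      (fun k t F ↦ ⟨E F t.length k, hE F t.length k⟩) s
  have hCsub (k : ℕ) (s : List ℕ) : (C (k :: s)).1 ⊆ (C s).1 ∩ U s.length :=
    hEsub (C s) s.length k
  have hdisc (n : ℕ) : ∀ x ∈ S, ∃ V ∈ 𝓝 x, ∀ s t : List ℕ, s.length = n → t.length = n →
      (V ∩ (C s).1).Nonempty → (V ∩ (C t).1).Nonempty → s = t := by
    induction n with
    | zero =>
      intro x _
      refine ⟨univ, Filter.univ_mem, fun s t hs ht _ _ ↦ ?_⟩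
      rw [List.length_eq_zero_iff.1 hs, List.length_eq_zero_iff.1 ht]
    | succ n ih =>
      intro x hx
      obtain ⟨V, hV, hVd⟩ := ih x hx
      by_cases hex : ∃ s : List ℕ, s.length = n ∧ (V ∩ (C s).1).Nonempty
      · obtain ⟨s, hs, hsV⟩ := hex
        obtain ⟨V', hV', hVd'⟩ := hEdisc (C s) n x hx
        refine ⟨V ∩ V', Filter.inter_mem hV hV', ?_⟩
        have aux : ∀ u : List ℕ, u.length = n + 1 → (V ∩ V' ∩ (C u).1).Nonempty →
            ∃ k, u = k :: s ∧ (V' ∩ E (C s) n k).Nonempty := by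
          rintro (_ | ⟨k, u⟩) hu ⟨y, ⟨hyV, hyV'⟩, hyu⟩
          · simp at hu
          · have hu' : u.length = n := by simpa using hu
            obtain rfl : u = s := hVd u s hu' hs ⟨y, hyV, (hCsub k u hyu).1⟩ hsV
            subst hs
            exact ⟨k, rfl, y, hyV', hyu⟩
        intro u v hu hv hu' hv'
        obtain ⟨k, rfl, hk⟩ := aux u hu hu'
        obtain ⟨l, rfl, hl⟩ := aux v hv hv'
        rw [hVd' k l hk hl]
      · refine ⟨V, hV, ?_⟩
        rintro (_ | ⟨k, u⟩) v hu hv ⟨y, hy, hyu⟩ _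
        · simp at hu
        · exact (hex ⟨u, by simpa using hu, y, hy, (hCsub k u hyu).1⟩).elim
  let D : Set S := {x | ∀ n, ∃ s : List ℕ, s.length = n ∧ (x : K) ∈ (C s).1}
  have hDc : IsClosed D := by
    rw [← isOpen_compl_iff, isOpen_iff_mem_nhds]
    intro x hx
    have hx' : ∃ n, ∀ s : List ℕ, s.length = n → (x : K) ∉ (C s).1 := by
      simpa [D] using hx
    obtain ⟨n, hn⟩ := hx'
    obtain ⟨V, hV, hVd⟩ := hdisc n x x.2
    by_cases hex : ∃ s : List ℕ, s.length = n ∧ (V ∩ (C s).1).Nonempty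
    · obtain ⟨s, hs, hsV⟩ := hex
      have hV' : V ∩ (C s).1ᶜ ∈ 𝓝 (x : K) :=
        Filter.inter_mem hV ((C s).2.1.isOpen_compl.mem_nhds (hn s hs))
      filter_upwards [continuous_subtype_val.continuousAt.preimage_mem_nhds hV'] with y hy hyD
      obtain ⟨t, ht, hyt⟩ := hyD n
      obtain rfl : t = s := hVd t s ht hs ⟨y, hy.1, hyt⟩ hsV
      exact hy.2 hyt
    · filter_upwards [continuous_subtype_val.continuousAt.preimage_mem_nhds hV] with y hy hyD
      obtain ⟨t, ht, hyt⟩ := hyD n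
      exact hex ⟨t, ht, y, hy, hyt⟩
  have huniq {x : K} (hx : x ∈ S) {s t : List ℕ} (hst : s.length = t.length)
      (hs : x ∈ (C s).1) (ht : x ∈ (C t).1) : s = t := by
    obtain ⟨V, hV, hVd⟩ := hdisc _ x hx
    exact hVd s t hst rfl ⟨x, mem_of_mem_nhds hV, hs⟩ ⟨x, mem_of_mem_nhds hV, ht⟩
  have hbranch (x : D) : ∃ α : ℕ → ℕ, ∀ n, (x : K) ∈ (C (PiNat.res α n)).1 := by
    choose s hs hxs using x.2
    have hres (n : ℕ) : s n = PiNat.res (fun n ↦ (s (n + 1)).headI) n := by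
      induction n with
      | zero => simpa using hs 0
      | succ n ih =>
        rw [PiNat.res_succ, ← ih]
        have h1 := hs (n + 1)
        have h2 := hxs (n + 1)
        rcases hsn : s (n + 1) with _ | ⟨k, u⟩
        · simp [hsn] at h1
        · rw [hsn] at h1 h2
          have : u = s n := huniq x.1.2 (by rw [hs]; simpa using h1) (hCsub k u h2).1 (hxs n)
          simp [this]
    exact ⟨_, fun n ↦ hres n ▸ hxs n⟩
  choose ψ hψ using hbranch
  refine ⟨D, hDc, ψ, ?_, ?_⟩
  · refine continuous_pi fun n ↦ IsLocallyConstant.continuous ?_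
    rw [IsLocallyConstant.iff_eventually_eq]
    intro x
    obtain ⟨V, hV, hVd⟩ := hdisc (n + 1) x x.1.2
    have hcont : Continuous fun y : D ↦ ((y : S) : K) :=
      continuous_subtype_val.comp continuous_subtype_val
    filter_upwards [hcont.continuousAt.preimage_mem_nhds hV] with y hy
    have := hVd _ _ (PiNat.res_length (ψ y) (n + 1)) (PiNat.res_length (ψ x) (n + 1))
      ⟨y, hy, hψ y (n + 1)⟩ ⟨x, mem_of_mem_nhds hV, hψ x (n + 1)⟩
    exact PiNat.res_eq_res.1 this n.lt_succ_self
  · intro α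
    have hne : (⋂ n, (C (PiNat.res α n)).1).Nonempty := by
      refine IsCompact.nonempty_iInter_of_sequence_nonempty_isCompact_isClosed _
        (fun n ↦ ?_) (fun n ↦ ?_) (C (PiNat.res α 0)).2.1.isCompact
        (fun n ↦ (C (PiNat.res α n)).2.1)
      · exact fun y hy ↦ (hCsub _ _ hy).1
      · by_contra hempty
        rw [not_nonempty_iff_eq_empty] at hempty
        apply (C (PiNat.res α n)).2.2
        rw [hempty, empty_inter]
        exact isSigmaCompact_empty
    obtain ⟨z, hz⟩ := hne
    rw [mem_iInter] at hz
    have hzS : z ∈ S := by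
      rw [hSU, mem_iInter]
      intro n
      have := (hCsub _ _ (hz (n + 1))).2
      rwa [PiNat.res_length] at this
    let x : D := ⟨⟨z, hzS⟩, fun n ↦ ⟨PiNat.res α n, PiNat.res_length α n, hz n⟩⟩
    refine ⟨x, PiNat.res_injective (funext fun n ↦ ?_)⟩
    exact huniq hzS (by rw [PiNat.res_length, PiNat.res_length]) (hψ x n) (hz n)

/-- The image of a Lindelöf space under a continuous surjection is Lindelöf. -/
lemma lindelofSpace_of_surjective {A B : Type*} [TopologicalSpace A] [TopologicalSpace B]
    [LindelofSpace A] {f : A → B} (hf : Continuous f) (hs : Surjective f) : LindelofSpace B := by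
  rw [← isLindelof_univ_iff, ← hs.range_eq, ← image_univ]
  exact isLindelof_univ.image hf

/-- A space is Čech-complete if it embeds as a `Gδ` subset of a compact Hausdorff space. -/
lemma CechComplete.of_isEmbedding {X K : Type u} [TopologicalSpace X] [TopologicalSpace K]
    [CompactSpace K] [T2Space K] {j : X → K} (hj : IsEmbedding j) (hG : IsGδ (range j)) :
    CechComplete X := by
  have key : range (stoneCechUnit : X → StoneCech X) =
      stoneCechExtend hj.continuous ⁻¹' range j := by
    refine Subset.antisymm ?_ ?_
    · rintro _ ⟨x, rfl⟩
      exact ⟨x, (stoneCechExtend_stoneCechUnit hj.continuous x).symm⟩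
    · rintro p ⟨x, hx⟩
      have hne : (Filter.comap stoneCechUnit (𝓝 p)).NeBot :=
        
        Filter.comap_neBot_iff_frequently.2
          (mem_closure_iff_frequently.1 (denseRange_stoneCechUnit p))
      have h1 : Filter.Tendsto (stoneCechUnit : X → StoneCech X)
          (Filter.comap stoneCechUnit (𝓝 p)) (𝓝 p) := Filter.tendsto_comap
      have h2 := (continuous_stoneCechExtend hj.continuous).continuousAt.tendsto.comp h1
      rw [stoneCechExtend_extends, ← hx] at h2
      have h3 : Filter.Tendsto id (Filter.comap (stoneCechUnit : X → StoneCech X) (𝓝 p)) (𝓝 x) :=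
        hj.tendsto_nhds_iff.2 h2
      exact ⟨x, tendsto_nhds_unique ((continuous_stoneCechUnit.tendsto x).comp h3) h1⟩
  rw [CechComplete, key]
  exact hG.preimage (continuous_stoneCechExtend hj.continuous)

/-- The Baire space is Čech-complete. -/
lemma cechComplete_baire : CechComplete (ULift.{u} (ℕ → ℕ)) := by
  let j : ULift.{u} (ℕ → ℕ) → ULift.{u} (ℕ → OnePoint ℕ) :=
    fun x ↦ ⟨fun n ↦ (x.down n : OnePoint ℕ)⟩
  have hj : IsEmbedding j :=
    Homeomorph.ulift.symm.isEmbedding.comp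
      ((IsEmbedding.piMap fun _ : ℕ ↦ OnePoint.isOpenEmbedding_coe.isEmbedding).comp
        Homeomorph.ulift.isEmbedding)
  refine CechComplete.of_isEmbedding hj ?_
  have : range j = ⋂ n, {x | x.down n ∈ range ((↑) : ℕ → OnePoint ℕ)} := by
    ext x
    simp only [mem_iInter]
    constructor
    · rintro ⟨y, rfl⟩ n
      exact ⟨_, rfl⟩
    · intro h
      choose y hy using h
      exact ⟨⟨y⟩, ULift.ext _ _ (funext hy)⟩
  rw [this]
  refine .iInter_of_isOpen fun n ↦ OnePoint.isOpenEmbedding_coe.isOpen_range.preimage ?_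
  exact (continuous_apply n).comp continuous_uliftDown

/-- The Baire space is not σ-compact. -/
lemma not_sigmaCompactSpace_baire : ¬ SigmaCompactSpace (ℕ → ℕ) := by
  intro h
  have hb (n : ℕ) : ∃ b, ∀ x ∈ compactCovering (ℕ → ℕ) n, x n ≤ b := by
    have := ((isCompact_compactCovering (ℕ → ℕ) n).image (continuous_apply n)).bddAbove
    obtain ⟨b, hb⟩ := this
    exact ⟨b, fun x hx ↦ hb ⟨x, hx, rfl⟩⟩
  choose b hb using hb
  obtain ⟨n, hn⟩ := exists_mem_compactCovering fun n ↦ b n + 1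
  exact absurd (hb n _ hn) (by simp)

/-- If there is a Michael space, a productively Lindelöf Čech-complete space is σ-compact. -/
lemma ProductivelyLindelof.sigmaCompactSpace (hM : ExistsMichaelSpace.{u}) {X : Type u}
    [TopologicalSpace X] [T35Space X] (hX : ProductivelyLindelof X) (hc : CechComplete X) :
    SigmaCompactSpace X := by
  obtain ⟨Y, _, _, hY, hYN⟩ := hM
  by_contra hns
  have hXL : LindelofSpace X := by
    have := hX PUnit inferInstance inferInstance inferInstance
    exact lindelofSpace_of_surjective continuous_fst
      (Prod.fst_surjective : Surjective (Prod.fst : X × PUnit → X))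
  obtain ⟨D, hD, ψ, hψ, hψs⟩ := exists_closed_surjection_baire
    (S := range (stoneCechUnit : X → StoneCech X))
    (by rw [← image_univ]; exact isLindelof_univ.image continuous_stoneCechUnit) hc (by
      rwa [← image_univ, ← isEmbedding_stoneCechUnit.isSigmaCompact_iff, isSigmaCompact_univ_iff])
  have hXY := hX Y inferInstance inferInstance hY
  have hSY : LindelofSpace (range (stoneCechUnit : X → StoneCech X) × Y) :=
    lindelofSpace_of_surjective
      ((continuous_stoneCechUnit.subtype_mk mem_range_self).prodMap continuous_id)
      (rangeFactorization_surjective.prodMap surjective_id)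
  have hDY : IsLindelof (D ×ˢ (univ : Set Y)) := (hD.prod isClosed_univ).isLindelof
  rw [isLindelof_iff_lindelofSpace] at hDY
  apply hYN
  let φ : ↥(D ×ˢ (univ : Set Y)) → Y × (ℕ → ℕ) := fun p ↦ (p.1.2, ψ ⟨p.1.1, p.2.1⟩)
  refine lindelofSpace_of_surjective (f := φ) ?_ ?_
  · exact (continuous_snd.comp continuous_subtype_val).prodMk
      (hψ.comp ((continuous_fst.comp continuous_subtype_val).subtype_mk _))
  · rintro ⟨y, α⟩
    obtain ⟨x, rfl⟩ := hψs α
    exact ⟨⟨(x, y), x.2, mem_univ y⟩, rfl⟩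

/-- If there is no Michael space, the Baire space is productively Lindelöf. -/
lemma productivelyLindelof_baire (hM : ¬ ExistsMichaelSpace.{u}) :
    ProductivelyLindelof (ULift.{u} (ℕ → ℕ)) := by
  intro Y _ _ hY
  have : LindelofSpace (Y × (ℕ → ℕ)) := by
    by_contra h
    exact hM ⟨Y, inferInstance, inferInstance, hY, h⟩
  let h : Y × (ℕ → ℕ) ≃ₜ ULift.{u} (ℕ → ℕ) × Y :=
    (Homeomorph.prodComm _ _).trans (Homeomorph.ulift.symm.prodCongr (Homeomorph.refl Y))
  exact lindelofSpace_of_surjective h.continuous h.surjective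

/-- There is a Michael space iff every productively Lindelöf Čech-complete
space is σ-compact. -/
theorem michael_iff_prodLindelof_cechComplete_sigmaCompact :
    ExistsMichaelSpace.{u} ↔
      ∀ (X : Type u) (_ : TopologicalSpace X) (_ : T35Space X),
        ProductivelyLindelof X → CechComplete X → SigmaCompactSpace X := by
  refine ⟨fun hM X _ _ hX hc ↦ hX.sigmaCompactSpace hM hc, fun h ↦ ?_⟩
  by_contra hM
  have := h (ULift.{u} (ℕ → ℕ)) inferInstance inferInstance (productivelyLindelof_baire hM)
    cechComplete_baire
  exact not_sigmaCompactSpace_baire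
    (Homeomorph.ulift.{u}.symm.isClosedEmbedding.sigmaCompactSpace)
end

section
/- Every Menger K-analytic space is projectively σ-compact. -/
open Set Function TopologicalSpace MeasureTheory

universe u

/-- The positions `s` reachable after `n` rounds of a selection game in which, at position `s`,
the answer `k` covers the set `O s k` and leads to the position `next n s k`, along plays that have
not yet covered `x`. -/
def uncoveredPositions {X S : Type*} (O : S → ℕ → Set X) (next : ℕ → S → ℕ → S) (s₀ : S) (x : X) :
    ℕ → Set S
  | 0 => {s₀}
  | n + 1 => {t | ∃ s ∈ uncoveredPositions O next s₀ x n, ∃ k, x ∉ O s k ∧ next n s k = t}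

section Game

variable {X S : Type*} {O : S → ℕ → Set X} {next : ℕ → S → ℕ → S} {s₀ : S}

theorem finite_uncoveredPositions (hmono : ∀ s, Monotone (O s)) (hcov : ∀ s x, ∃ k, x ∈ O s k)
    (x : X) (n : ℕ) : (uncoveredPositions O next s₀ x n).Finite := by
  induction n with
  | zero => exact finite_singleton _
  | succ n ih =>
    have h : uncoveredPositions O next s₀ x (n + 1) =
        ⋃ s ∈ uncoveredPositions O next s₀ x n, next n s '' {k | x ∉ O s k} := by
      ext t
      simp [uncoveredPositions]
    rw [h]
    refine ih.biUnion fun s _ => Finite.image _ ?_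
    obtain ⟨m, hm⟩ := hcov s x
    refine (finite_lt_nat m).subset fun k hk => ?_
    by_contra hkm
    exact hk (hmono s (not_lt.1 hkm) hm)

theorem eventually_uncoveredPositions_subset [TopologicalSpace X]
    (hopen : ∀ s k, IsOpen (O s k)) (hmono : ∀ s, Monotone (O s))
    (hcov : ∀ s x, ∃ k, x ∈ O s k) (x : X) (n : ℕ) :
    ∀ᶠ y in nhds x, uncoveredPositions O next s₀ y n ⊆ uncoveredPositions O next s₀ x n := by
  induction n with
  | zero => exact Filter.Eventually.of_forall fun y => subset_rfl
  | succ n ih =>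
    have h : ∀ᶠ y in nhds x, ∀ s ∈ uncoveredPositions O next s₀ x n, ∀ k, x ∈ O s k → y ∈ O s k := by
      rw [Filter.eventually_all_finite (finite_uncoveredPositions hmono hcov x n)]
      intro s _
      classical
      filter_upwards [(hopen s _).mem_nhds (Nat.find_spec (hcov s x))] with y hy k hk
      exact hmono s (Nat.find_min' _ hk) hy
    filter_upwards [ih, h] with y hy hy'
    rintro t ⟨s, hs, k, hk, rfl⟩
    exact ⟨s, hy hs, k, fun hx => hk (hy' s (hy hs) k hx), rfl⟩

/-- Hurewicz: in a Menger space, the player who offers increasing open covers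
does not have a winning strategy in the Menger game. -/
theorem MengerSpace.exists_winning_play [TopologicalSpace X] (hX : MengerSpace X)
    (hopen : ∀ s k, IsOpen (O s k)) (hmono : ∀ s, Monotone (O s))
    (hcov : ∀ s x, ∃ k, x ∈ O s k) (next : ℕ → S → ℕ → S) (s₀ : S) :
    ∃ (σ : ℕ → ℕ) (s : ℕ → S), s 0 = s₀ ∧ (∀ n, s (n + 1) = next n (s n) (σ n)) ∧
      ∀ x, ∃ n, x ∈ O (s n) (σ n) := by
  let R := uncoveredPositions O next s₀
  let G : ℕ → ℕ → Set X := fun n m => {x | ∀ s ∈ R x n, x ∈ O s m}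
  have hGmono : ∀ n, Monotone (G n) := fun n a b hab x hx s hs => hmono s hab (hx s hs)
  have hGopen : ∀ n m, IsOpen (G n m) := by
    intro n m
    rw [isOpen_iff_mem_nhds]
    intro x hx
    have h : ∀ᶠ y in nhds x, ∀ s ∈ R x n, y ∈ O s m := by
      rw [Filter.eventually_all_finite (finite_uncoveredPositions hmono hcov x n)]
      exact fun s hs => (hopen s m).mem_nhds (hx s hs)
    filter_upwards [eventually_uncoveredPositions_subset hopen hmono hcov x n, h] with y hy hy' s hs
    exact hy' s (hy hs)
  have hGcov : ∀ n x, ∃ m, x ∈ G n m := by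
    intro n x
    choose k hk using fun s => hcov s x
    obtain ⟨m, hm⟩ := ((finite_uncoveredPositions (next := next) (s₀ := s₀)
      hmono hcov x n).image k).bddAbove
    exact ⟨m, fun s hs => hmono s (hm (mem_image_of_mem k hs)) (hk s)⟩
  obtain ⟨V, hV, hVcov⟩ := hX (fun n => range (G n))
    (by rintro n _ ⟨m, rfl⟩; exact hGopen n m)
    (fun n => eq_univ_of_forall fun x => by simpa using hGcov n x)
  have hbound : ∀ n, ∃ m, ∀ v ∈ V n, v ⊆ G n m := by
    intro n
    choose! k hk using (hV n).1
    obtain ⟨m, hm⟩ := ((hV n).2.image k).bddAbove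
    exact ⟨m, fun v hv => (hk hv).symm.subset.trans (hGmono n (hm (mem_image_of_mem k hv)))⟩
  choose σ hσ using hbound
  let s : ℕ → S := fun n => Nat.rec s₀ (fun n t => next n t (σ n)) n
  refine ⟨σ, s, rfl, fun n => rfl, fun x => ?_⟩
  by_contra! hx
  have hs : ∀ n, s n ∈ R x n := by
    intro n
    induction n with
    | zero => exact rfl
    | succ n ih => exact ⟨s n, ih, σ n, hx n, rfl⟩
  obtain ⟨v, hv, hxv⟩ : x ∈ ⋃₀ ⋃ n, V n := hVcov ▸ mem_univ x
  obtain ⟨n, hn⟩ := mem_iUnion.1 hv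
  exact hx n (hσ n v hn hxv (s n) (hs n))

end Game

/-- The image of `B` under `p` is contained in a σ-compact subset of the range of `p`. -/
def SigmaCompactlyBounded {Y M : Type*} [TopologicalSpace M] (p : Y → M) (B : Set Y) : Prop :=
  ∃ S ⊆ range p, IsSigmaCompact S ∧ p '' B ⊆ S

section Bounded

variable {Y M : Type*} [TopologicalSpace M] {p : Y → M}

theorem SigmaCompactlyBounded.mono {B C : Set Y} (hC : SigmaCompactlyBounded p C) (h : B ⊆ C) :
    SigmaCompactlyBounded p B := by
  obtain ⟨S, hS, hS', hC⟩ := hC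
  exact ⟨S, hS, hS', (image_mono h).trans hC⟩

theorem SigmaCompactlyBounded.iUnion {ι : Type*} [Countable ι] {B : ι → Set Y}
    (h : ∀ i, SigmaCompactlyBounded p (B i)) : SigmaCompactlyBounded p (⋃ i, B i) := by
  choose S hS hS' hB using h
  exact ⟨⋃ i, S i, iUnion_subset hS, isSigmaCompact_iUnion S hS', by
    rw [image_iUnion]; exact iUnion_mono hB⟩

theorem SigmaCompactlyBounded.union {B C : Set Y} (hB : SigmaCompactlyBounded p B)
    (hC : SigmaCompactlyBounded p C) : SigmaCompactlyBounded p (B ∪ C) := by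
  rw [union_eq_iUnion]
  exact .iUnion (by simp [hB, hC])

/-- A set that is not σ-compactly bounded contains one that is nowhere σ-compactly bounded. -/
theorem exists_subset_nowhere_sigmaCompactlyBounded [SecondCountableTopology M] {B : Set Y}
    (hB : ¬ SigmaCompactlyBounded p B) :
    ∃ C ⊆ B, ¬ SigmaCompactlyBounded p C ∧ ∀ V : Set M, IsOpen V → (C ∩ p ⁻¹' V).Nonempty →
      ¬ SigmaCompactlyBounded p (C ∩ p ⁻¹' V) := by
  let I := {U : Set M // U ∈ countableBasis M ∧ SigmaCompactlyBounded p (B ∩ p ⁻¹' U)}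
  have : Countable I := ((countable_countableBasis M).mono fun U hU => hU.1 :
    {U : Set M | U ∈ countableBasis M ∧ SigmaCompactlyBounded p (B ∩ p ⁻¹' U)}.Countable)
  let N : Set Y := ⋃ U : I, B ∩ p ⁻¹' U.1
  have hN : SigmaCompactlyBounded p N := .iUnion fun U => U.2.2
  refine ⟨B \ N, sdiff_subset, fun h => hB ((h.union hN).mono ?_), ?_⟩
  · intro y hy
    by_cases h : y ∈ N
    exacts [.inr h, .inl ⟨hy, h⟩]
  · rintro V hV ⟨y, ⟨hyB, hyN⟩, hyV⟩ h
    obtain ⟨U, hU, hyU, hUV⟩ := (isBasis_countableBasis M).exists_subset_of_mem_open hyV hV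
    refine hyN (mem_iUnion.2 ⟨⟨U, hU, (h.union hN).mono ?_⟩, hyB, hyU⟩)
    rintro z ⟨hzB, hzU⟩
    by_cases hz : z ∈ N
    exacts [.inr hz, .inl ⟨⟨hzB, hz⟩, hUV hzU⟩]

theorem exists_open_cover_not_sigmaCompactlyBounded [SecondCountableTopology M] [T3Space M]
    {B : Set Y} (hB : ¬ SigmaCompactlyBounded p B) :
    ∃ O : ℕ → Set M, (∀ k, IsOpen (O k)) ∧ Monotone O ∧ range p ⊆ ⋃ k, O k ∧
      ∀ k, ¬ SigmaCompactlyBounded p (B \ p ⁻¹' O k) := by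
  obtain ⟨C, hCB, hC, hloc⟩ := exists_subset_nowhere_sigmaCompactlyBounded hB
  have hK : ¬ IsCompact (closure (p '' C) ∩ range p) := fun h =>
    hC ⟨_, inter_subset_right, h.isSigmaCompact,
      subset_inter subset_closure (image_subset_range p C)⟩
  have : ∃ (ι : Type _) (W : ι → Set M), (∀ i, IsOpen (W i)) ∧
      closure (p '' C) ∩ range p ⊆ ⋃ i, W i ∧
      ∀ t : Finset ι, ¬ closure (p '' C) ∩ range p ⊆ ⋃ i ∈ t, W i := by
    by_contra! h
    exact hK (isCompact_of_finite_subcover fun W hW hcov => h _ W hW hcov)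
  obtain ⟨ι, W, hWo, hWcov, hWfin⟩ := this
  have hnhd : ∀ a : range p, ∃ V : Set M, IsOpen V ∧ a.1 ∈ V ∧
      ∃ t : Finset ι, closure V ∩ (closure (p '' C) ∩ range p) ⊆ ⋃ i ∈ t, W i := by
    rintro ⟨a, ha⟩
    by_cases haC : a ∈ closure (p '' C)
    · obtain ⟨i, hi⟩ := mem_iUnion.1 (hWcov ⟨haC, ha⟩)
      obtain ⟨V, hV, hVc, hVW⟩ := exists_mem_nhds_isClosed_subset ((hWo i).mem_nhds hi)
      refine ⟨interior V, isOpen_interior, mem_interior_iff_mem_nhds.2 hV, {i}, ?_⟩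
      simpa using inter_subset_left.trans
        ((closure_minimal interior_subset hVc).trans hVW)
    · obtain ⟨V, hV, hVc, hVW⟩ :=
        exists_mem_nhds_isClosed_subset (isClosed_closure.isOpen_compl.mem_nhds haC)
      refine ⟨interior V, isOpen_interior, mem_interior_iff_mem_nhds.2 hV, ∅, ?_⟩
      rintro x ⟨hx, hx', _⟩
      exact absurd hx' (hVW (closure_minimal interior_subset hVc hx))
  choose V hVo hVmem t ht using hnhd
  have : Nonempty (range p) := by
    by_contra h
    rw [nonempty_coe_sort, not_nonempty_iff_eq_empty] at h
    exact hWfin ∅ (by simp [h])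
  obtain ⟨f, hf⟩ := (HereditarilyLindelofSpace.isLindelof (range p)).indexed_countable_subcover V hVo
    fun a ha => mem_iUnion.2 ⟨⟨a, ha⟩, hVmem _⟩
  refine ⟨accumulate fun n => V (f n), fun k => isOpen_biUnion fun n _ => hVo _,
    monotone_accumulate, by rwa [iUnion_accumulate], fun k h => ?_⟩
  classical
  have hne : (C ∩ p ⁻¹' (closure (accumulate (fun n => V (f n)) k))ᶜ).Nonempty := by
    by_contra hempty
    refine hWfin ((Finset.range (k + 1)).biUnion fun n => t (f n)) ?_
    rintro x ⟨hxC, hxp⟩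
    have hsub : p '' C ⊆ closure (accumulate (fun n => V (f n)) k) := by
      rintro _ ⟨y, hy, rfl⟩
      by_contra hy'
      exact hempty ⟨y, hy, hy'⟩
    have hx := closure_minimal hsub isClosed_closure hxC
    have hacc : accumulate (fun n => V (f n)) k = ⋃ n ∈ {n | n ≤ k}, V (f n) := rfl
    rw [hacc, (finite_le_nat k).closure_biUnion] at hx
    obtain ⟨n, hn, hxn⟩ := mem_iUnion₂.1 hx
    obtain ⟨i, hi, hxi⟩ := mem_iUnion₂.1 (ht (f n) ⟨hxn, hxC, hxp⟩)
    exact mem_iUnion₂.2 ⟨i, Finset.mem_biUnion.2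
      ⟨n, Finset.mem_range.2 (Nat.lt_succ_of_le hn), hi⟩, hxi⟩
  refine hloc _ isClosed_closure.isOpen_compl hne (h.mono ?_)
  rintro y ⟨hy, hy'⟩
  exact ⟨hCB hy, fun h => hy' (subset_closure h)⟩

end Bounded

/-- In a Lindelöf Čech-complete space there are countable covers such that any decreasing sequence
of nonempty sets refining them has a common adherent point. -/
theorem CechComplete.exists_complete_covers {Y : Type u} [TopologicalSpace Y] [T35Space Y]
    [LindelofSpace Y] (hY : CechComplete Y) :
    ∃ F : ℕ → ℕ → Set Y, (∀ n, ⋃ j, F n j = univ) ∧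
      ∀ B : ℕ → Set Y, Antitone B → (∀ n, (B n).Nonempty) → (∀ n, ∃ j, B (n + 1) ⊆ F n j) →
        ∃ y, ∀ n, y ∈ closure (B n) := by
  obtain ⟨G, hGo, hG⟩ := hY.eq_iInter_nat
  have key : ∀ n, ∃ F : ℕ → Set Y, ⋃ j, F j = univ ∧
      ∀ j, closure (stoneCechUnit '' F j) ⊆ G n := by
    intro n
    rcases isEmpty_or_nonempty Y with hE | hE
    · exact ⟨fun _ => ∅, Subsingleton.elim _ _, by simp⟩
    have h : ∀ y : Y, ∃ V : Set Y, IsOpen V ∧ y ∈ V ∧ closure (stoneCechUnit '' V) ⊆ G n := by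
      intro y
      have hy : stoneCechUnit y ∈ G n := by
        have : stoneCechUnit y ∈ ⋂ n, G n := hG ▸ mem_range_self y
        exact mem_iInter.1 this n
      obtain ⟨V, hV, hVc, hVG⟩ := exists_mem_nhds_isClosed_subset ((hGo n).mem_nhds hy)
      refine ⟨stoneCechUnit ⁻¹' interior V, isOpen_interior.preimage continuous_stoneCechUnit,
        mem_interior_iff_mem_nhds.2 hV, (closure_minimal ?_ hVc).trans hVG⟩
      exact (image_preimage_subset _ _).trans interior_subset
    choose V hVo hVmem hV using h
    obtain ⟨f, hf⟩ := isLindelof_univ.indexed_countable_subcover V hVo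
      fun y _ => mem_iUnion.2 ⟨y, hVmem y⟩
    exact ⟨fun j => V (f j), univ_subset_iff.1 hf, fun j => hV _⟩
  choose F hFcov hF using key
  refine ⟨F, hFcov, fun B hBanti hBne hBF => ?_⟩
  obtain ⟨z, hz⟩ := IsCompact.nonempty_iInter_of_sequence_nonempty_isCompact_isClosed
    (fun n => closure (stoneCechUnit '' B n))
    (fun n => closure_mono (image_mono (hBanti n.le_succ)))
    (fun n => ((hBne n).image _).closure) isClosed_closure.isCompact (fun n => isClosed_closure)
  rw [mem_iInter] at hz
  have hzY : z ∈ range (stoneCechUnit : Y → StoneCech Y) := by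
    rw [hG, mem_iInter]
    intro n
    obtain ⟨j, hj⟩ := hBF n
    exact hF n j (closure_mono (image_mono hj) (hz (n + 1)))
  obtain ⟨y, rfl⟩ := hzY
  refine ⟨y, fun n => ?_⟩
  rw [isEmbedding_stoneCechUnit.closure_eq_preimage_closure_image]
  exact hz n

/-- Menger K-analytic spaces are projectively σ-compact. -/
theorem menger_kAnalytic_projectivelySigmaCompact
    (X : Type u) [TopologicalSpace X] [T35Space X]
    (hM : MengerSpace X) (hK : KAnalytic X) : ProjectivelySigmaCompact X := by
  intro M _ _ _ f hf
  obtain ⟨Y, _, _, _, hY, g, hg, hgsurj⟩ := hK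
  let _ : MetricSpace M := metrizableSpaceMetric M
  have : SecondCountableTopology M := UniformSpace.secondCountable_of_separable M
  obtain ⟨F, hFcov, hF⟩ := hY.exists_complete_covers
  let p : Y → M := f ∘ g
  have hp : Continuous p := hf.comp hg
  have hrange : range p = range f := hgsurj.range_comp f
  by_cases hbdd : SigmaCompactlyBounded p univ
  · obtain ⟨S, hS, hS', hpS⟩ := hbdd
    rw [image_univ] at hpS
    rwa [← hrange, subset_antisymm hpS hS]
  exfalso
  let P := {B : Set Y // ¬ SigmaCompactlyBounded p B}
  choose O hOo hOmono hOcov hO using fun B : P => exists_open_cover_not_sigmaCompactlyBounded B.2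
  have hnext : ∀ (n : ℕ) (B : P) (k : ℕ), ∃ C : P, C.1 ⊆ B.1 \ p ⁻¹' O B k ∧ ∃ j, C.1 ⊆ F n j := by
    intro n B k
    have : ∃ j, ¬ SigmaCompactlyBounded p ((B.1 \ p ⁻¹' O B k) ∩ F n j) := by
      by_contra! h
      have h' := SigmaCompactlyBounded.iUnion h
      rw [← inter_iUnion, hFcov, inter_univ] at h'
      exact hO B k h'
    obtain ⟨j, hj⟩ := this
    exact ⟨⟨_, hj⟩, inter_subset_left, j, inter_subset_right⟩
  choose next hnextO hnextF using hnext
  have hOcov' : ∀ (B : P) x, ∃ k, x ∈ f ⁻¹' O B k := fun B x => by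
    simpa using hOcov B (hrange.symm.subset (mem_range_self x))
  obtain ⟨σ, s, -, hs, hcov⟩ := hM.exists_winning_play (O := fun B k => f ⁻¹' O B k)
    (fun B k => (hOo B k).preimage hf) (fun B _ _ h => preimage_mono (hOmono B h))
    hOcov' next ⟨univ, hbdd⟩
  have hstep : ∀ n, (s (n + 1)).1 ⊆ (s n).1 \ p ⁻¹' O (s n) (σ n) := fun n =>
    hs n ▸ hnextO n (s n) (σ n)
  obtain ⟨y, hy⟩ := hF (fun n => (s n).1)
    (antitone_nat_of_succ_le fun n => (hstep n).trans sdiff_subset)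
    (fun n => nonempty_iff_ne_empty.2 fun h => (s n).2 ⟨∅, empty_subset _, isSigmaCompact_empty, by
      rw [h, image_empty]⟩)
    (fun n => hs n ▸ hnextF n (s n) (σ n))
  obtain ⟨n, hn⟩ := hcov (g y)
  exact closure_minimal (fun z hz => (hstep n hz).2)
    ((hOo (s n) (σ n)).preimage hp).isClosed_compl (hy (n + 1)) hn
end

section
/- Every K-analytic Rothberger space is projectively countable. -/
open Set Function TopologicalSpace MeasureTheory

universe u

/-- An uncountable set in a second countable space contains one of its condensation points. -/
theorem exists_mem_forall_nhds_not_countable_inter {α : Type*} [TopologicalSpace α]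
    [SecondCountableTopology α] {s : Set α} (hs : ¬ s.Countable) :
    ∃ x ∈ s, ∀ U ∈ nhds x, ¬ (s ∩ U).Countable := by
  by_contra! h
  choose! U hU hc using h
  obtain ⟨t, hts, ht, hcov⟩ :=
    countable_cover_nhdsWithin (s := s) fun x hx => mem_nhdsWithin_of_mem_nhds (hU x hx)
  refine hs ((ht.biUnion fun x hx => hc x (hts hx)).mono fun y hy => ?_)
  obtain ⟨x, hx, hyx⟩ := mem_iUnion₂.1 (hcov hy)
  exact mem_iUnion₂.2 ⟨x, hx, hy, hyx⟩

theorem exists_disjoint_isClosed_not_countable_inter {α : Type*} [TopologicalSpace α]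
    [SecondCountableTopology α] [T25Space α] {s : Set α} (hs : ¬ s.Countable) :
    ∃ A B : Set α, IsClosed A ∧ IsClosed B ∧ Disjoint A B ∧
      ¬ (s ∩ A).Countable ∧ ¬ (s ∩ B).Countable := by
  obtain ⟨x, -, hx⟩ := exists_mem_forall_nhds_not_countable_inter hs
  have hs' : ¬ (s \ {x}).Countable := fun h => hs (by simpa using h.union (countable_singleton x))
  obtain ⟨y, hy, hy'⟩ := exists_mem_forall_nhds_not_countable_inter hs'
  obtain ⟨U, hU, V, hV, hd⟩ := exists_nhds_disjoint_closure (x := x) (y := y) (Ne.symm hy.2)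
  refine ⟨closure U, closure V, isClosed_closure, isClosed_closure, hd, fun h => ?_, fun h => ?_⟩
  · exact hx U hU (h.mono (inter_subset_inter_right _ subset_closure))
  · exact hy' V hV (h.mono (inter_subset_inter sdiff_subset subset_closure))

theorem IsClosed.exists_subset_ediam_le_not_countable_image {α β : Type*} [MetricSpace α]
    [SecondCountableTopology α] {F : α → β} {C : Set α} (hC : IsClosed C)
    (hn : ¬ (F '' C).Countable) {ε : ENNReal} (hε : 0 < ε) :
    ∃ D ⊆ C, IsClosed D ∧ ¬ (F '' D).Countable ∧ Metric.ediam D ≤ ε := by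
  by_contra! h
  obtain ⟨t, ht, hcov⟩ := TopologicalSpace.countable_cover_nhds fun x : α =>
    Metric.closedEBall_mem_nhds x (ENNReal.half_pos hε.ne')
  have hc : ∀ x, (F '' (C ∩ Metric.closedEBall x (ε / 2))).Countable := by
    intro x
    by_contra hx
    refine (h _ inter_subset_left (hC.inter Metric.isClosed_closedEBall) hx).not_ge ?_
    refine (Metric.ediam_mono inter_subset_right).trans (Metric.ediam_closedEBall_le.trans ?_)
    rw [ENNReal.mul_div_cancel (by simp) (by simp)]
  refine hn ((ht.biUnion fun x _ => hc x).mono ?_)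
  rintro _ ⟨y, hy, rfl⟩
  obtain ⟨x, hx, hyx⟩ := mem_iUnion₂.1 (hcov.ge (mem_univ y))
  exact mem_iUnion₂.2 ⟨x, hx, y, ⟨hy, hyx⟩, rfl⟩

theorem IsClosed.exists_splitting_not_countable_image {α β : Type*} [MetricSpace α]
    [SecondCountableTopology α] [TopologicalSpace β] [SecondCountableTopology β] [T25Space β]
    {F : α → β} (hF : Continuous F) {C : Set α} (hC : IsClosed C)
    (hn : ¬ (F '' C).Countable) {ε : ENNReal} (hε : 0 < ε) :
    ∃ D : Bool → Set α, (∀ b, D b ⊆ C ∧ IsClosed (D b) ∧ ¬ (F '' D b).Countable ∧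
      Metric.ediam (D b) ≤ ε) ∧ Disjoint (F '' D false) (F '' D true) := by
  obtain ⟨A, B, hA, hB, hd, hnA, hnB⟩ := exists_disjoint_isClosed_not_countable_inter hn
  rw [← image_inter_preimage] at hnA hnB
  obtain ⟨D₀, h₀, h₀'⟩ := (hC.inter (hA.preimage hF)).exists_subset_ediam_le_not_countable_image
    hnA hε
  obtain ⟨D₁, h₁, h₁'⟩ := (hC.inter (hB.preimage hF)).exists_subset_ediam_le_not_countable_image
    hnB hε
  refine ⟨fun b => bif b then D₁ else D₀, ?_, hd.mono ?_ ?_⟩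
  · rintro (_ | _)
    exacts [⟨h₀.trans inter_subset_left, h₀'⟩, ⟨h₁.trans inter_subset_left, h₁'⟩]
  · exact image_subset_iff.2 (h₀.trans inter_subset_right)
  · exact image_subset_iff.2 (h₁.trans inter_subset_right)

open CantorScheme PiNat Filter in
/-- If a continuous map on a Polish space has uncountable range, then some Cantor set in its
domain is mapped injectively. -/
theorem Continuous.exists_nat_bool_injective_comp {α β : Type*} [TopologicalSpace α]
    [PolishSpace α] [TopologicalSpace β] [SecondCountableTopology β] [T25Space β]
    {F : α → β} (hF : Continuous F) (hn : ¬ (range F).Countable) :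
    ∃ g : (ℕ → Bool) → α, Continuous g ∧ Injective (F ∘ g) := by
  let := upgradeIsCompletelyMetrizable α
  obtain ⟨u, -, upos, hu⟩ := exists_seq_strictAnti_tendsto' (zero_lt_one' ENNReal)
  let P := {E : Set α // IsClosed E ∧ ¬ (F '' E).Countable}
  choose S hS hdisj using fun (E : P) (n : ℕ) =>
    E.2.1.exists_splitting_not_countable_image hF E.2.2 (upos n).1
  let T : List Bool → P := fun l => l.rec ⟨univ, isClosed_univ, by rwa [image_univ]⟩
    fun b l E => ⟨S E l.length b, (hS E l.length b).2.1, (hS E l.length b).2.2.1⟩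
  let D : List Bool → Set α := fun l => (T l).1
  have hanti : ClosureAntitone D :=
    Antitone.closureAntitone (fun l b => (hS (T l) l.length b).1) fun l => (T l).2.1
  have hdiam : VanishingDiam D := by
    intro x
    rw [← tendsto_add_atTop_iff_nat 1]
    refine tendsto_of_tendsto_of_tendsto_of_le_of_le tendsto_const_nhds hu
      (fun _ => zero_le) fun n => ?_
    exact (hS (T (res x n)) (res x n).length (x n)).2.2.2.trans_eq (by rw [res_length])
  have hne : ∀ l, (D l).Nonempty := by
    intro l
    by_contra h
    exact (T l).2.2 (by simp [show (T l).1 = ∅ from not_nonempty_iff_eq_empty.1 h])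
  have hdom : ∀ x, x ∈ (inducedMap D).1 := by
    simp [hanti.map_of_vanishingDiam hdiam hne]
  have hsep : ∀ l a b, a ≠ b → Disjoint (F '' D (a :: l)) (F '' D (b :: l)) := by
    rintro l (_ | _) (_ | _) hab
    exacts [(hab rfl).elim, hdisj (T l) l.length, (hdisj (T l) l.length).symm, (hab rfl).elim]
  refine ⟨fun x => (inducedMap D).2 ⟨x, hdom x⟩,
    hdiam.map_continuous.comp (continuous_id.subtype_mk hdom), fun x y hxy => ?_⟩
  apply res_injective
  ext n : 1
  induction n with
  | zero => simp
  | succ n ih =>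
    have hx := mem_image_of_mem F (map_mem (A := D) ⟨x, hdom x⟩ (n + 1))
    have hy := mem_image_of_mem F (map_mem (A := D) ⟨y, hdom y⟩ (n + 1))
    rw [res_succ] at hx hy
    simp only [res_succ, List.cons.injEq]
    refine ⟨?_, ih⟩
    by_contra hne
    refine disjoint_left.1 (hsep _ _ _ hne) hx ?_
    rw [ih]
    have : F ((inducedMap D).2 ⟨x, hdom x⟩) = F ((inducedMap D).2 ⟨y, hdom y⟩) := hxy
    rwa [this]

/-- A continuous image of a Rothberger space contains no Cantor set. -/
theorem RothbergerSpace.not_range_subset {X K : Type*} [TopologicalSpace X] [TopologicalSpace K]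
    [T2Space K] (hR : RothbergerSpace X) {f : X → K} (hf : Continuous f)
    {g : (ℕ → Bool) → K} (hg : Continuous g) (hinj : Injective g) : ¬ range g ⊆ range f := by
  intro hsub
  obtain ⟨V, hV, hcov⟩ := hR
    (fun n => {O | IsOpen O ∧ ∃ b : Bool, ∀ x, ∀ p ∈ O, g x = f p → x n = b})
    (fun _ _ hO => hO.1) fun n => by
      refine eq_univ_of_forall fun p => ?_
      obtain ⟨b, hb⟩ : ∃ b : Bool, f p ∉ g '' {x | x n = !b} := by
        by_contra! h
        obtain ⟨x, hx, hxp⟩ := h true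
        obtain ⟨y, hy, hyp⟩ := h false
        obtain rfl := hinj (hxp.trans hyp.symm)
        simp_all
      have hcl : IsClosed (g '' {x | x n = !b}) :=
        ((isClosed_singleton.preimage (continuous_apply n)).isCompact.image hg).isClosed
      refine ⟨f ⁻¹' (g '' {x | x n = !b})ᶜ, ⟨hcl.isOpen_compl.preimage hf, b, ?_⟩, hb⟩
      intro x q hq hxq
      by_contra hne
      exact hq ⟨x, Bool.eq_not.2 hne, hxq⟩
  choose hVo b hb using hV
  obtain ⟨p, hp⟩ := hsub (mem_range_self fun n => !b n)
  obtain ⟨n, hn⟩ := mem_iUnion.1 (hcov.ge (mem_univ p))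
  simpa using hb n _ p hn hp.symm

/-- A Lindelöf Čech-complete space is an `Fσδ` subset of its Stone–Čech compactification. -/
theorem CechComplete.exists_range_eq_iInter_iUnion_isClosed {Y : Type u} [TopologicalSpace Y] [LindelofSpace Y]
    [Nonempty Y] (hY : CechComplete Y) :
    ∃ C : ℕ → ℕ → Set (StoneCech Y), (∀ n k, IsClosed (C n k)) ∧
      range (stoneCechUnit : Y → StoneCech Y) = ⋂ n, ⋃ k, C n k := by
  obtain ⟨G, hGo, hG⟩ := IsGδ.eq_iInter_nat hY
  have hmem : ∀ n (y : Y), G n ∈ nhds (stoneCechUnit y) := fun n y =>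
    (hGo n).mem_nhds (mem_iInter.1 (hG.le (mem_range_self y)) n)
  choose N hN hNc hNG using fun n y => exists_mem_nhds_isClosed_subset (hmem n y)
  have hcount : ∀ n, ∃ e : ℕ → Y, ∀ y, ∃ k, stoneCechUnit y ∈ N n (e k) := by
    intro n
    obtain ⟨t, ht, hcov⟩ := LindelofSpace.elim_nhds_subcover (fun y => stoneCechUnit ⁻¹' N n y)
      fun y => continuous_stoneCechUnit.continuousAt (hN n y)
    obtain ⟨e, he⟩ := countable_iff_exists_subset_range.1 ht
    refine ⟨e, fun y => ?_⟩
    obtain ⟨z, hz, hyz⟩ := mem_iUnion₂.1 (hcov.ge (mem_univ y))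
    obtain ⟨k, rfl⟩ := he hz
    exact ⟨k, hyz⟩
  choose e he using hcount
  refine ⟨fun n k => N n (e n k), fun n k => hNc _ _, Subset.antisymm ?_ ?_⟩
  · rintro _ ⟨y, rfl⟩
    exact mem_iInter.2 fun n => mem_iUnion.2 (he n y)
  · rw [hG]
    exact iInter_mono fun n => iUnion_subset fun k => hNG _ _

/-- A continuous image of a Lindelöf Čech-complete space in a compact Polish space is analytic. -/
theorem CechComplete.analyticSet_range {Y : Type u} [TopologicalSpace Y] [LindelofSpace Y]
    (hY : CechComplete Y) {K : Type*} [TopologicalSpace K] [CompactSpace K] [PolishSpace K]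
    {h : Y → K} (hh : Continuous h) : AnalyticSet (range h) := by
  rcases isEmpty_or_nonempty Y with hE | hE
  · rw [range_eq_empty]
    exact analyticSet_empty
  obtain ⟨C, hC, hYC⟩ := hY.exists_range_eq_iInter_iUnion_isClosed
  let H : StoneCech Y → K := stoneCechExtend hh
  have hH : Continuous H := continuous_stoneCechExtend hh
  let Γ : Set (((ℕ → ℕ) × K) × StoneCech Y) := {q | (∀ n, q.2 ∈ C n (q.1.1 n)) ∧ H q.2 = q.1.2}
  have hΓ : IsClosed Γ := by
    refine IsClosed.inter ?_ (isClosed_eq (by fun_prop) (by fun_prop))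
    have hrw : {q : ((ℕ → ℕ) × K) × StoneCech Y | ∀ n, q.2 ∈ C n (q.1.1 n)} =
        ⋂ n, ⋂ k, {q | q.1.1 n = k}ᶜ ∪ {q | q.2 ∈ C n k} := by
      ext q
      simp [imp_iff_not_or.symm]
    change IsClosed {q : ((ℕ → ℕ) × K) × StoneCech Y | ∀ n, q.2 ∈ C n (q.1.1 n)}
    rw [hrw]
    refine isClosed_iInter fun n => isClosed_iInter fun k => IsClosed.union ?_ ?_
    · exact ((isOpen_discrete {k}).preimage (f := fun q : ((ℕ → ℕ) × K) × StoneCech Y => q.1.1 n)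
        (by fun_prop)).isClosed_compl
    · exact (hC n k).preimage continuous_snd
  have himage : range h = Prod.snd '' (Prod.fst '' Γ) := by
    ext z
    constructor
    · rintro ⟨y, rfl⟩
      choose s hs using fun n => mem_iUnion.1 (mem_iInter.1 (hYC.le (mem_range_self y)) n)
      exact ⟨(s, h y), ⟨((s, h y), stoneCechUnit y),
        ⟨hs, stoneCechExtend_stoneCechUnit hh y⟩, rfl⟩, rfl⟩
    · rintro ⟨_, ⟨⟨⟨s, z⟩, w⟩, ⟨hs, hw⟩, rfl⟩, rfl⟩
      obtain ⟨y, rfl⟩ := hYC.ge (mem_iInter.2 fun n => mem_iUnion.2 ⟨s n, hs n⟩)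
      exact ⟨y, (stoneCechExtend_stoneCechUnit hh y).symm.trans hw⟩
  rw [himage]
  exact ((isClosedMap_fst_of_compactSpace _ hΓ).analyticSet).image_of_continuous continuous_snd

/-- K-analytic Rothberger spaces are projectively countable. -/
theorem kAnalytic_rothberger_projectivelyCountable
    (X : Type u) [TopologicalSpace X] [T35Space X]
    (hK : KAnalytic X) (hR : RothbergerSpace X) : ProjectivelyCountable X := by
  intro M _ _ _ f hf
  obtain ⟨Y, _, _, _, hY, p, hp, hps⟩ := hK
  let := metrizableSpaceMetric M
  have := UniformSpace.secondCountable_of_separable M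
  obtain ⟨F, hF⟩ := Metric.PiNatEmbed.exists_embedding_to_hilbert_cube (X := M)
  have hA : AnalyticSet (range (F ∘ f)) := by
    rw [← hps.range_comp (F ∘ f)]
    exact hY.analyticSet_range ((hF.continuous.comp hf).comp hp)
  by_contra hn
  have hn' : ¬ (range (F ∘ f)).Countable := fun h => hn <|
    countable_of_injective_of_countable_image hF.injective.injOn (range_comp F f ▸ h)
  rw [analyticSet_iff_exists_polishSpace_range] at hA
  obtain ⟨P, _, _, φ, hφ, hr⟩ := hA
  rw [← hr] at hn'
  obtain ⟨g, hg, hinj⟩ := hφ.exists_nat_bool_injective_comp hn'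
  refine hR.not_range_subset (hF.continuous.comp hf) (hφ.comp hg) hinj ?_
  rw [← hr]
  exact range_comp_subset_range g φ
end
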